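/- arXiv:0708.1034 — 4 statements merged into one kernel-verified Lean document; each statement's English description precedes it below -/
import Mathlib

section
/- The halting problem for two-counter machines is undecidable: there is no algorithm which, given (a code of) a counter machine (S, Γ), an initial configuration (s⁰, z₁⁰, z₂⁰) and a halting configuration (s*, z₁*, z₂*), decides whether the trajectory started from the initial configuration ever reaches the halting configuration. Formally, the set of codes of triples (counter machine, initial configuration, halting configuration) for which the halting configuration is reached in finite time is not a computable predicate. -/
/-- The set of allowed counter increments of a two-counter machine. -/
def CM.Deltas : Set (ℤ × ℤ) := {(-1, 0), (0, -1), (0, 0), (1, 0), (0, 1)}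

/-- One step of a two-counter machine with transition function `Γ`:
a configuration `(s, z₁, z₂)` is updated to `(s', (z₁ + d₁)⁺, (z₂ + d₂)⁺)`
where `(s', (d₁, d₂)) = Γ s 1{z₁ > 0} 1{z₂ > 0}`. -/
def CM.step {S : Type*} (Γ : S → Bool → Bool → S × ℤ × ℤ) (c : S × ℕ × ℕ) : S × ℕ × ℕ :=
  let r := Γ c.1 (decide (0 < c.2.1)) (decide (0 < c.2.2))
  (r.1, ((c.2.1 : ℤ) + r.2.1).toNat, ((c.2.2 : ℤ) + r.2.2).toNat)

/-- The trajectory of the counter machine `Γ` started from configuration `c`. -/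
def CM.traj {S : Type*} (Γ : S → Bool → Bool → S × ℤ × ℤ) (c : S × ℕ × ℕ) (t : ℕ) :
    S × ℕ × ℕ :=
  (CM.step Γ)^[t] c

/-- `Γ` is a valid counter-machine transition function: every increment lies in
`CM.Deltas`, and `Γ` is consistent (it never decrements a counter whose value is zero). -/
def CM.Valid {S : Type*} (Γ : S → Bool → Bool → S × ℤ × ℤ) : Prop :=
  (∀ s b₁ b₂, (Γ s b₁ b₂).2 ∈ CM.Deltas) ∧
  (∀ s b₁ b₂, ((Γ s b₁ b₂).2.1 = -1 → b₁ = true) ∧ ((Γ s b₁ b₂).2.2 = -1 → b₂ = true))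

/-- The machine `Γ` started at configuration `c` is stable: both counter values
are bounded along the trajectory. -/
def CM.Stable {S : Type*} (Γ : S → Bool → Bool → S × ℤ × ℤ) (c : S × ℕ × ℕ) : Prop :=
  ∃ B : ℕ, ∀ t : ℕ, (CM.traj Γ c t).2.1 ≤ B ∧ (CM.traj Γ c t).2.2 ≤ B

/-- `Γ` is a simplified counter machine: the increment applied at each step is a
function of the new state only. -/
def CM.IsSCM {S : Type*} (Γ : S → Bool → Bool → S × ℤ × ℤ) : Prop :=
  ∃ (α : S → Bool → Bool → S) (β : S → ℤ × ℤ),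
    ∀ s b₁ b₂, Γ s b₁ b₂ = (α s b₁ b₂, β (α s b₁ b₂))

/-- The allowed increments, as a type. -/
def CM.Delta : Type := {d : ℤ × ℤ // d ∈ CM.Deltas}

/-- The simplified counter machine associated to a counter machine `Γ`, with state
space `S ⊕ (S × D)`: `Γ' (inl s) b₁ b₂ = (inr (s', Δ), Δ)` where `(s', Δ) = Γ s b₁ b₂`,
and `Γ' (inr (s', Δ)) b₁ b₂ = (inl s', (0, 0))`. -/
def CM.simplify {S : Type*} (Γ : S → Bool → Bool → S × ℤ × ℤ)
    (h : ∀ s b₁ b₂, (Γ s b₁ b₂).2 ∈ CM.Deltas) :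
    (S ⊕ S × CM.Delta) → Bool → Bool → (S ⊕ S × CM.Delta) × ℤ × ℤ
  | Sum.inl s, b₁, b₂ =>
      (Sum.inr ((Γ s b₁ b₂).1, ⟨(Γ s b₁ b₂).2, h s b₁ b₂⟩), (Γ s b₁ b₂).2)
  | Sum.inr p, _, _ => (Sum.inl p.1, (0, 0))

/-- Codes of instances of the halting problem for two-counter machines: a machine
with state set `Fin m`, an initial configuration and a halting configuration. -/
def CMHaltCode : Type :=
  Σ m : ℕ, (Fin m → Bool → Bool → Fin m × ℤ × ℤ) × (Fin m × ℕ × ℕ) × (Fin m × ℕ × ℕ)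

instance : Encodable CMHaltCode := by unfold CMHaltCode; infer_instance

namespace CM

/-- A piece of a two-counter machine, entered at `start` and left through one of the exits `E`. -/
structure Fragment (E : Type) where
  /-- The internal states. -/
  S : Type
  fin : Finite S
  /-- The state in which the fragment is entered. -/
  start : S
  /-- The successor state or exit. -/
  next : S → Bool → Bool → S ⊕ E
  /-- The increments applied to the counters. -/
  act : S → Bool → Bool → ℤ × ℤ
  act_mem : ∀ s b₁ b₂, act s b₁ b₂ ∈ Deltas
  act_consistent : ∀ s b₁ b₂,
    ((act s b₁ b₂).1 = -1 → b₁ = true) ∧ ((act s b₁ b₂).2 = -1 → b₂ = true)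

namespace Fragment

variable {E E' : Type}

/-- The successor state or exit of `F` in state `s` with counters `c`. -/
def target (F : Fragment E) (s : F.S) (c : ℕ × ℕ) : F.S ⊕ E :=
  F.next s (decide (0 < c.1)) (decide (0 < c.2))

/-- The counters after one step of `F` from state `s` with counters `c`. -/
def counters (F : Fragment E) (s : F.S) (c : ℕ × ℕ) : ℕ × ℕ :=
  let d := F.act s (decide (0 < c.1)) (decide (0 < c.2))
  (((c.1 : ℤ) + d.1).toNat, ((c.2 : ℤ) + d.2).toNat)

/-- Started in state `s` with counters `c`, the fragment leaves through `e` with counters `d`. -/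
inductive Reaches (F : Fragment E) : F.S → ℕ × ℕ → E → ℕ × ℕ → Prop
  | leave {s c e} : F.target s c = Sum.inr e → Reaches F s c e (F.counters s c)
  | step {s c s' e d} : F.target s c = Sum.inl s' → Reaches F s' (F.counters s c) e d →
      Reaches F s c e d

/-- Started with counters `c`, the fragment leaves through `e` with counters `d`. -/
def Run (F : Fragment E) (c : ℕ × ℕ) (e : E) (d : ℕ × ℕ) : Prop := F.Reaches F.start c e d

/-- Increment the first counter. -/
def incFst : Fragment Unit where
  S := Unit
  fin := inferInstance
  start := ()
  next _ _ _ := Sum.inr ()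
  act _ _ _ := (1, 0)
  act_mem := by simp [Deltas]
  act_consistent := by simp

/-- Increment the second counter. -/
def incSnd : Fragment Unit where
  S := Unit
  fin := inferInstance
  start := ()
  next _ _ _ := Sum.inr ()
  act _ _ _ := (0, 1)
  act_mem := by simp [Deltas]
  act_consistent := by simp

/-- Leave immediately through `e`. -/
def ret (e : E) : Fragment E where
  S := Unit
  fin := inferInstance
  start := ()
  next _ _ _ := Sum.inr e
  act _ _ _ := (0, 0)
  act_mem := by simp [Deltas]
  act_consistent := by simp

/-- Decrement the first counter if it is positive, and report whether it was. -/
def decFst : Fragment Bool where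
  S := Unit
  fin := inferInstance
  start := ()
  next _ b₁ _ := Sum.inr b₁
  act _ b₁ _ := (if b₁ then -1 else 0, 0)
  act_mem := by intro _ b₁ _; cases b₁ <;> simp [Deltas]
  act_consistent := by intro _ b₁ _; cases b₁ <;> simp

/-- Decrement the second counter if it is positive, and report whether it was. -/
def decSnd : Fragment Bool where
  S := Unit
  fin := inferInstance
  start := ()
  next _ _ b₂ := Sum.inr b₂
  act _ _ b₂ := (0, if b₂ then -1 else 0)
  act_mem := by intro _ _ b₂; cases b₂ <;> simp [Deltas]
  act_consistent := by intro _ _ b₂; cases b₂ <;> simp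

/-- Run `F`, then continue with the fragment selected by the exit. -/
def bind [Finite E] (F : Fragment E) (G : E → Fragment E') : Fragment E' where
  S := F.S ⊕ Σ e, (G e).S
  fin := by
    have := F.fin
    have := fun e => (G e).fin
    infer_instance
  start := Sum.inl F.start
  next
    | Sum.inl s, b₁, b₂ =>
        (F.next s b₁ b₂).elim (fun s' => Sum.inl (Sum.inl s'))
          (fun e => Sum.inl (Sum.inr ⟨e, (G e).start⟩))
    | Sum.inr ⟨e, s⟩, b₁, b₂ =>
        ((G e).next s b₁ b₂).elim (fun s' => Sum.inl (Sum.inr ⟨e, s'⟩)) Sum.inr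
  act
    | Sum.inl s, b₁, b₂ => F.act s b₁ b₂
    | Sum.inr ⟨e, s⟩, b₁, b₂ => (G e).act s b₁ b₂
  act_mem := by
    rintro (s | ⟨e, s⟩) b₁ b₂
    · exact F.act_mem s b₁ b₂
    · exact (G e).act_mem s b₁ b₂
  act_consistent := by
    rintro (s | ⟨e, s⟩) b₁ b₂
    · exact F.act_consistent s b₁ b₂
    · exact (G e).act_consistent s b₁ b₂

/-- Run `F` until it leaves through `false`. -/
def rep (F : Fragment Bool) : Fragment Unit where
  S := F.S
  fin := F.fin
  start := F.start
  next s b₁ b₂ :=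
    (F.next s b₁ b₂).elim Sum.inl (fun e => if e then Sum.inl F.start else Sum.inr ())
  act := F.act
  act_mem := F.act_mem
  act_consistent := F.act_consistent

/-- Run `F` and then `G`. -/
def seq (F : Fragment Unit) (G : Fragment E) : Fragment E := F.bind fun _ => G

/-- Run `B` as long as the test `T` succeeds. -/
def loop (T : Fragment Bool) (B : Fragment Unit) : Fragment Unit :=
  rep (T.bind fun e => if e then B.seq (ret true) else ret false)

theorem run_incFst (a b : ℕ) : incFst.Run (a, b) () (a + 1, b) :=
  Reaches.leave (F := incFst) (s := ()) (c := (a, b)) rfl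

theorem run_incSnd (a b : ℕ) : incSnd.Run (a, b) () (a, b + 1) :=
  Reaches.leave (F := incSnd) (s := ()) (c := (a, b)) rfl

theorem run_ret (e : E) (c : ℕ × ℕ) : (ret e).Run c e c := by
  have := Reaches.leave (F := ret e) (s := ()) (c := c) rfl
  simpa [Run, counters, ret] using this

theorem run_decFst_succ (a b : ℕ) : decFst.Run (a + 1, b) true (a, b) := by
  have := Reaches.leave (F := decFst) (s := ()) (c := (a + 1, b)) (e := true)
    (by simp [target, decFst])
  simpa [Run, counters, decFst] using this

theorem run_decFst_zero (b : ℕ) : decFst.Run (0, b) false (0, b) :=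
  Reaches.leave (F := decFst) (s := ()) (c := (0, b)) rfl

theorem run_decSnd_succ (a b : ℕ) : decSnd.Run (a, b + 1) true (a, b) := by
  have := Reaches.leave (F := decSnd) (s := ()) (c := (a, b + 1)) (e := true)
    (by simp [target, decSnd])
  simpa [Run, counters, decSnd] using this

theorem run_decSnd_zero (a : ℕ) : decSnd.Run (a, 0) false (a, 0) :=
  Reaches.leave (F := decSnd) (s := ()) (c := (a, 0)) rfl

theorem Run.bind [Finite E] {F : Fragment E} {G : E → Fragment E'} {c c' d : ℕ × ℕ} {e : E}
    {e' : E'} (hF : F.Run c e c') (hG : (G e).Run c' e' d) : (F.bind G).Run c e' d := by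
  have second : ∀ {e s c d}, (G e).Reaches s c e' d →
      (F.bind G).Reaches (Sum.inr ⟨e, s⟩) c e' d := by
    intro e s c d h
    clear hG
    induction h with
    | leave h =>
      refine Reaches.leave (F := F.bind G) ?_
      simp only [target] at h
      simp [target, Fragment.bind, h]
    | step h _ ih =>
      refine Reaches.step (F := F.bind G) ?_ (ih)
      simp only [target] at h
      simp [target, Fragment.bind, h]
  have first : ∀ {e s c c'}, F.Reaches s c e c' → (G e).Run c' e' d →
      (F.bind G).Reaches (Sum.inl s) c e' d := by
    intro e s c c' h hG
    clear hF
    induction h with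
    | leave h =>
      refine Reaches.step (F := F.bind G) ?_ (second hG)
      simp only [target] at h
      simp [target, Fragment.bind, h]
    | step h _ ih =>
      refine Reaches.step (F := F.bind G) ?_ (ih hG)
      simp only [target] at h
      simp [target, Fragment.bind, h]
  exact first hF hG

theorem Run.seq {F : Fragment Unit} {G : Fragment E} {c c' d : ℕ × ℕ} {e : E}
    (hF : F.Run c () c') (hG : G.Run c' e d) : (F.seq G).Run c e d :=
  Run.bind hF hG

theorem Run.rep_false {F : Fragment Bool} {c d : ℕ × ℕ} (hF : F.Run c false d) :
    F.rep.Run c () d := by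
  have : ∀ {s e}, F.Reaches s c e d → e = false → F.rep.Reaches s c () d := by
    intro s e h he
    clear hF
    induction h with
    | leave h =>
      refine Reaches.leave (F := F.rep) ?_
      simp only [target] at h
      simp [target, rep, h, he]
    | step h _ ih =>
      refine Reaches.step (F := F.rep) ?_ (ih he)
      simp only [target] at h
      simp [target, rep, h]
  exact this hF rfl

theorem Run.rep_true {F : Fragment Bool} {c c' d : ℕ × ℕ} (hF : F.Run c true c')
    (hd : F.rep.Run c' () d) : F.rep.Run c () d := by
  have : ∀ {s c c' e}, F.Reaches s c e c' → e = true → F.rep.Run c' () d →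
      F.rep.Reaches s c () d := by
    intro s c c' e h he hd
    induction h with
    | leave h =>
      refine Reaches.step (F := F.rep) (s' := F.start) ?_ hd
      simp only [target] at h
      simp [target, rep, h, he]
    | step h _ ih =>
      refine Reaches.step (F := F.rep) ?_ (ih he hd)
      simp only [target] at h
      simp [target, rep, h]
  exact this hF rfl hd

theorem Run.loop_false {T : Fragment Bool} {B : Fragment Unit} {c d : ℕ × ℕ}
    (hT : T.Run c false d) : (T.loop B).Run c () d :=
  Run.rep_false (hT.bind (run_ret false d))

theorem Run.loop_true {T : Fragment Bool} {B : Fragment Unit} {c c₁ c₂ d : ℕ × ℕ}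
    (hT : T.Run c true c₁) (hB : B.Run c₁ () c₂) (hd : (T.loop B).Run c₂ () d) :
    (T.loop B).Run c () d :=
  Run.rep_true (hT.bind (hB.seq (run_ret true c₂) : (B.seq (ret true)).Run c₁ true c₂)) hd

/-- Add `k` to the first counter. -/
def addFst : ℕ → Fragment Unit
  | 0 => ret ()
  | k + 1 => incFst.seq (addFst k)

/-- Add `k` to the second counter. -/
def addSnd : ℕ → Fragment Unit
  | 0 => ret ()
  | k + 1 => incSnd.seq (addSnd k)

theorem run_addFst (k a b : ℕ) : (addFst k).Run (a, b) () (a + k, b) := by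
  induction k generalizing a with
  | zero => exact run_ret _ _
  | succ k ih => exact (run_incFst a b).seq (by simpa [add_assoc, add_comm 1] using ih (a + 1))

theorem run_addSnd (k a b : ℕ) : (addSnd k).Run (a, b) () (a, b + k) := by
  induction k generalizing b with
  | zero => exact run_ret _ _
  | succ k ih => exact (run_incSnd a b).seq (by simpa [add_assoc, add_comm 1] using ih (b + 1))

/-- Empty the second counter, adding `k` to the first one for each unit removed. -/
def pourSnd (k : ℕ) : Fragment Unit := decSnd.loop (addFst k)

/-- Empty the first counter, adding `k` to the second one for each unit removed. -/
def pourFst (k : ℕ) : Fragment Unit := decFst.loop (addSnd k)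

theorem run_pourSnd (k a b : ℕ) : (pourSnd k).Run (a, b) () (a + k * b, 0) := by
  induction b generalizing a with
  | zero => exact Run.loop_false (run_decSnd_zero a)
  | succ b ih =>
    refine Run.loop_true (run_decSnd_succ a b) (run_addFst k a b) ?_
    rw [show a + k * (b + 1) = a + k + k * b by ring]
    exact ih (a + k)

theorem run_pourFst (k a b : ℕ) : (pourFst k).Run (a, b) () (0, b + k * a) := by
  induction a generalizing b with
  | zero => exact Run.loop_false (run_decFst_zero b)
  | succ a ih =>
    refine Run.loop_true (run_decFst_succ a b) (run_addSnd k a b) ?_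
    rw [show b + k * (a + 1) = b + k + k * a by ring]
    exact ih (b + k)

/-- Multiply the first counter by `k`, using the second one as scratch space. -/
def mul (k : ℕ) : Fragment Unit := (pourFst k).seq (pourSnd 1)

theorem run_mul (k a : ℕ) : (mul k).Run (a, 0) () (a * k, 0) := by
  refine (run_pourFst k a 0).seq ?_
  convert run_pourSnd 1 0 (0 + k * a) using 2
  ring

/-- If the first counter is at least `k`, subtract `k` from it and increment the second one;
otherwise leave both unchanged. Report which case occurred. -/
def trySub : ℕ → Fragment Bool
  | 0 => incSnd.seq (ret true)
  | k + 1 => decFst.bind fun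
    | true => (trySub k).bind fun
      | true => ret true
      | false => incFst.seq (ret false)
    | false => ret false

theorem run_trySub_add (k a b : ℕ) : (trySub k).Run (a + k, b) true (a, b + 1) := by
  induction k with
  | zero => exact (run_incSnd a b).seq (run_ret _ _)
  | succ k ih => exact (run_decFst_succ (a + k) b).bind (ih.bind (run_ret _ _))

theorem run_trySub_lt {k a : ℕ} (b : ℕ) (h : a < k) : (trySub k).Run (a, b) false (a, b) := by
  induction k generalizing a with
  | zero => omega
  | succ k ih =>
    cases a with
    | zero => exact (run_decFst_zero b).bind (run_ret _ _)
    | succ a =>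
      exact (run_decFst_succ a b).bind
        ((ih (by omega)).bind ((run_incFst a b).seq (run_ret _ _)))

theorem run_rep_trySub {k r : ℕ} (q b : ℕ) (h : r < k) :
    (trySub k).rep.Run (r + k * q, b) () (r, b + q) := by
  induction q generalizing b with
  | zero => exact Run.rep_false (run_trySub_lt b h)
  | succ q ih =>
    refine Run.rep_true (c' := (r + k * q, b + 1)) ?_ ?_
    · convert run_trySub_add k (r + k * q) b using 2
      ring
    · convert ih (b + 1) using 2
      ring

/-- Divide the first counter by `k` if it is a multiple of `k`, and report whether it was; the
second counter is scratch space. -/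
def divide (k : ℕ) : Fragment Bool :=
  (trySub k).rep.seq <| decFst.bind fun
    | true => incFst.seq ((pourSnd k).seq (ret false))
    | false => (pourSnd 1).seq (ret true)

theorem run_divide_mul {k : ℕ} (a : ℕ) (hk : 0 < k) : (divide k).Run (a * k, 0) true (a, 0) := by
  refine Run.seq (c' := (0, a)) ?_ ?_
  · convert run_rep_trySub a 0 hk using 2
    · ring
    · simp
  · refine (run_decFst_zero a).bind (Run.seq (c' := (a, 0)) ?_ (run_ret _ _))
    convert run_pourSnd 1 0 a using 2
    ring

theorem run_divide_of_not_dvd {k a : ℕ} (hk : 0 < k) (h : ¬ k ∣ a) :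
    (divide k).Run (a, 0) false (a, 0) := by
  obtain ⟨r, hr⟩ : ∃ r, a % k = r + 1 :=
    Nat.exists_eq_succ_of_ne_zero fun h0 => h (Nat.dvd_of_mod_eq_zero h0)
  have ha : r + 1 + k * (a / k) = a := by rw [← hr, Nat.mod_add_div]
  refine Run.seq (c' := (r + 1, a / k)) ?_ ?_
  · convert run_rep_trySub (a / k) 0 (hr ▸ Nat.mod_lt a hk) using 2
    · exact ha.symm
    · simp
  · refine (run_decFst_succ r _).bind
      ((run_incFst r _).seq (Run.seq (c' := (a, 0)) ?_ (run_ret _ _)))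
    convert run_pourSnd k (r + 1) (a / k) using 2
    exact ha.symm

end Fragment

/-- The Gödel number of a register assignment. -/
noncomputable def godel (σ : ℕ →₀ ℕ) : ℕ := σ.prod fun r k => Nat.nth Nat.Prime r ^ k

theorem godel_single (r k : ℕ) : godel (Finsupp.single r k) = Nat.nth Nat.Prime r ^ k :=
  Finsupp.prod_single_index (pow_zero _)

theorem godel_update (σ : ℕ →₀ ℕ) (r k : ℕ) :
    godel (σ.update r k) = godel (σ.erase r) * Nat.nth Nat.Prime r ^ k := by
  rw [Finsupp.update_eq_erase_add_single, godel,
    Finsupp.prod_add_index' (fun _ => pow_zero _) fun _ _ _ => pow_add _ _ _]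
  exact congrArg _ (godel_single r k)

theorem godel_update_succ (σ : ℕ →₀ ℕ) (r k : ℕ) :
    godel (σ.update r (k + 1)) = godel (σ.update r k) * Nat.nth Nat.Prime r := by
  rw [godel_update, godel_update, pow_succ, mul_assoc]

theorem not_dvd_godel {σ : ℕ →₀ ℕ} {r : ℕ} (h : σ r = 0) :
    ¬ Nat.nth Nat.Prime r ∣ godel σ := by
  refine Prime.not_dvd_finsuppProd (Nat.prime_nth_prime r).prime fun i hi hd => ?_
  have := (Nat.prime_dvd_prime_iff_eq (Nat.prime_nth_prime r) (Nat.prime_nth_prime i)).1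
    ((Nat.prime_nth_prime r).dvd_of_dvd_pow hd)
  have hri : r = i := Nat.nth_injective Nat.infinite_setOfPred_prime this
  exact Finsupp.mem_support_iff.1 hi (hri ▸ h)

namespace Fragment

variable {E E' : Type}

/-- Started with the code of the registers `σ`, the fragment leaves through `e` with the code
of `τ`. -/
def Exec (F : Fragment E) (σ : ℕ →₀ ℕ) (e : E) (τ : ℕ →₀ ℕ) : Prop :=
  F.Run (godel σ, 0) e (godel τ, 0)

/-- Increment the register `r`. -/
noncomputable def incReg (r : ℕ) : Fragment Unit := mul (Nat.nth Nat.Prime r)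

/-- Decrement the register `r` if it is positive, and report whether it was. -/
noncomputable def decReg (r : ℕ) : Fragment Bool := divide (Nat.nth Nat.Prime r)

/-- Run `B` once for each unit removed from the register `r`, until `r` is empty. -/
noncomputable def forReg (r : ℕ) (B : Fragment Unit) : Fragment Unit := (decReg r).loop B

theorem exec_incReg (r : ℕ) (σ : ℕ →₀ ℕ) : (incReg r).Exec σ () (σ.update r (σ r + 1)) := by
  have := run_mul (Nat.nth Nat.Prime r) (godel σ)
  unfold Exec
  rwa [godel_update_succ, Finsupp.update_self]

theorem Exec.seq {F : Fragment Unit} {G : Fragment E} {σ ρ τ : ℕ →₀ ℕ} {e : E}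
    (hF : F.Exec σ () ρ) (hG : G.Exec ρ e τ) : (F.seq G).Exec σ e τ :=
  Run.seq hF hG

theorem exec_decReg_zero {r : ℕ} {σ : ℕ →₀ ℕ} (h : σ r = 0) : (decReg r).Exec σ false σ :=
  run_divide_of_not_dvd (Nat.prime_nth_prime r).pos (not_dvd_godel h)

theorem exec_decReg_succ {r k : ℕ} {σ : ℕ →₀ ℕ} (h : σ r = k + 1) :
    (decReg r).Exec σ true (σ.update r k) := by
  have := run_divide_mul (godel (σ.update r k)) (Nat.prime_nth_prime r).pos
  rwa [← godel_update_succ, ← h, Finsupp.update_self] at this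

theorem Exec.forReg_zero {r : ℕ} {B : Fragment Unit} {σ : ℕ →₀ ℕ} (h : σ r = 0) :
    (forReg r B).Exec σ () σ :=
  Run.loop_false (exec_decReg_zero h)

theorem Exec.forReg_succ {r k : ℕ} {B : Fragment Unit} {σ ρ τ : ℕ →₀ ℕ} (h : σ r = k + 1)
    (hB : B.Exec (σ.update r k) () ρ) (hτ : (forReg r B).Exec ρ () τ) :
    (forReg r B).Exec σ () τ :=
  Run.loop_true (exec_decReg_succ h) hB hτ

/-- Set the register `r` to zero. -/
noncomputable def clear (r : ℕ) : Fragment Unit := forReg r (ret ())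

theorem exec_clear (r : ℕ) (σ : ℕ →₀ ℕ) : (clear r).Exec σ () (σ.update r 0) := by
  induction h : σ r generalizing σ with
  | zero =>
    rw [← h, Finsupp.update_self]
    exact Exec.forReg_zero h
  | succ k ih =>
    refine Exec.forReg_succ h (run_ret _ _) ?_
    rw [← Finsupp.update_idem σ r k 0]
    exact ih _ (by simp)

/-- Add the register `r` to the register `s`, and set `r` to zero. -/
noncomputable def move (r s : ℕ) : Fragment Unit := forReg r (incReg s)

theorem exec_move {r s : ℕ} (hrs : r ≠ s) (σ : ℕ →₀ ℕ) :
    (move r s).Exec σ () ((σ.update s (σ s + σ r)).update r 0) := by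
  unfold move
  induction h : σ r generalizing σ with
  | zero =>
    convert Exec.forReg_zero h using 1
    ext i
    grind
  | succ k ih =>
    refine Exec.forReg_succ h (exec_incReg s _) ?_
    convert ih _ ?_ using 1
    · ext i
      grind
    · grind

/-- Add the register `r` to the register `s`, using the empty register `t` as scratch space. -/
noncomputable def copy (r s t : ℕ) : Fragment Unit :=
  (forReg r ((incReg s).seq (incReg t))).seq (move t r)

theorem exec_copy {r s t : ℕ} (hrs : r ≠ s) (hrt : r ≠ t) (hst : s ≠ t) {σ : ℕ →₀ ℕ}
    (ht : σ t = 0) : (copy r s t).Exec σ () (σ.update s (σ s + σ r)) := by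
  have key : ∀ n (σ : ℕ →₀ ℕ), σ r = n → (forReg r ((incReg s).seq (incReg t))).Exec σ ()
      (((σ.update s (σ s + σ r)).update t (σ t + σ r)).update r 0) := by
    intro n
    induction n with
    | zero =>
      intro σ h
      convert Exec.forReg_zero h using 1
      ext i
      grind
    | succ k ih =>
      intro σ h
      refine Exec.forReg_succ h ((exec_incReg s _).seq (exec_incReg t _)) ?_
      convert ih _ ?_ using 1
      · ext i
        grind
      · grind
  refine (key _ σ rfl).seq ?_
  convert exec_move hrt.symm _ using 1
  ext i
  grind

end Fragment

open Fragment

/-- For any placement of the arguments (in registers `inp` below `b`) and of the result (in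
register `o` below `b`), some fragment computes `f`, using the registers from `b` on as scratch
space. -/
def Implementable {n : ℕ} (f : List.Vector ℕ n →. ℕ) : Prop :=
  ∀ (inp : Fin n → ℕ) (o b : ℕ), (∀ i, inp i < b) → (∀ i, inp i ≠ o) → o < b →
    ∃ F : Fragment Unit, ∀ (σ : ℕ →₀ ℕ) (v : List.Vector ℕ n), (∀ r, b ≤ r → σ r = 0) →
      σ o = 0 → (∀ i, σ (inp i) = v.get i) → ∀ y ∈ f v, F.Exec σ () (σ.update o y)

namespace Implementable

theorem zero : Implementable (fun _ : List.Vector ℕ 0 => Part.some 0) := by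
  intro inp o b _ _ _
  refine ⟨ret (), fun σ v _ ho _ y hy => ?_⟩
  rw [Part.mem_some_iff.1 hy, ← ho, Finsupp.update_self]
  exact run_ret _ _

theorem get {n : ℕ} (i : Fin n) :
    Implementable (fun v : List.Vector ℕ n => Part.some (v.get i)) := by
  intro inp o b hb hne hob
  refine ⟨copy (inp i) o b, fun σ v hz ho hv y hy => ?_⟩
  convert exec_copy (hne i) (hb i).ne hob.ne (hz b le_rfl) using 2
  rw [Part.mem_some_iff.1 hy, ho, hv, zero_add]

theorem succ : Implementable (fun v : List.Vector ℕ 1 => Part.some v.head.succ) := by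
  intro inp o b hb hne hob
  refine ⟨(copy (inp 0) o b).seq (incReg o), fun σ v hz ho hv y hy => ?_⟩
  refine (exec_copy (hne 0) (hb 0).ne hob.ne (hz b le_rfl)).seq ?_
  convert exec_incReg o _ using 1
  rw [Part.mem_some_iff.1 hy, ho, hv, List.Vector.get_zero]
  simp

theorem mem_of_mem_mOfFn {α : Type*} {m : ℕ} {g : Fin m → Part α} {w : List.Vector α m}
    (h : w ∈ List.Vector.mOfFn g) (i : Fin m) : w.get i ∈ g i := by
  induction m with
  | zero => exact i.elim0
  | succ m ih =>
    simp only [List.Vector.mOfFn, Part.bind_eq_bind, Part.mem_bind_iff, Part.pure_eq_some,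
      Part.mem_some_iff] at h
    obtain ⟨a, ha, u, hu, rfl⟩ := h
    refine Fin.cases ?_ (fun j => ?_) i
    · simpa using ha
    · simpa using ih hu j

theorem comp {m n : ℕ} {f : List.Vector ℕ n →. ℕ} {g : Fin n → List.Vector ℕ m →. ℕ}
    (hf : Implementable f) (hg : ∀ i, Implementable (g i)) :
    Implementable fun v => (List.Vector.mOfFn fun i => g i v) >>= f := by
  intro inp o b hb hne hob
  have arguments : ∀ k ≤ n, ∃ F : Fragment Unit, ∀ (σ : ℕ →₀ ℕ) (v : List.Vector ℕ m)
      (w : List.Vector ℕ n), (∀ r, b ≤ r → σ r = 0) → (∀ i, σ (inp i) = v.get i) →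
      (∀ i, w.get i ∈ g i v) → ∃ τ, F.Exec σ () τ ∧ (∀ r, r < b ∨ b + k ≤ r → τ r = σ r) ∧
        ∀ i : Fin n, i < k → τ (b + i) = w.get i := by
    intro k
    induction k with
    | zero => exact fun _ => ⟨ret (), fun σ v w _ _ _ => ⟨σ, run_ret _ _, by simp, by simp⟩⟩
    | succ k ih =>
      intro hk
      obtain ⟨F, hF⟩ := ih (by omega)
      obtain ⟨G, hG⟩ := hg ⟨k, hk⟩ inp (b + k) (b + n) (fun i => (hb i).trans_le (by omega))
        (fun i => by have := hb i; omega) (by omega)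
      refine ⟨F.seq G, fun σ v w hz hv hw => ?_⟩
      obtain ⟨τ, hτ, hout, hin⟩ := hF σ v w hz hv hw
      refine ⟨_, hτ.seq (hG τ v ?_ ?_ ?_ _ (hw ⟨k, hk⟩)), ?_, ?_⟩
      · intro r hr
        rw [hout r (by omega), hz r (by omega)]
      · rw [hout _ (by omega), hz _ (by omega)]
      · intro i
        rw [hout _ (Or.inl (hb i)), hv]
      · intro r hr
        rw [Finsupp.update_apply, if_neg (by omega), hout r (by omega)]
      · intro i hi
        rw [Finsupp.update_apply]
        split_ifs with h
        · congr
          omega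
        · exact hin i (by omega)
  have clearing : ∀ k, ∃ F : Fragment Unit, ∀ σ : ℕ →₀ ℕ, ∃ τ, F.Exec σ () τ ∧
      ∀ r, τ r = if b ≤ r ∧ r < b + k then 0 else σ r := by
    intro k
    induction k with
    | zero => exact ⟨ret (), fun σ => ⟨σ, run_ret _ _, fun r => by rw [if_neg (by omega)]⟩⟩
    | succ k ih =>
      obtain ⟨F, hF⟩ := ih
      refine ⟨F.seq (clear (b + k)), fun σ => ?_⟩
      obtain ⟨τ, hτ, h⟩ := hF σ
      refine ⟨_, hτ.seq (exec_clear _ _), fun r => ?_⟩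
      grind
  obtain ⟨A, hA⟩ := arguments n le_rfl
  obtain ⟨C, hC⟩ := clearing n
  obtain ⟨F, hF⟩ := hf (fun i => b + i) o (b + n) (fun i => by omega) (fun i => by omega)
    (by omega)
  refine ⟨A.seq (F.seq C), fun σ v hz ho hv y hy => ?_⟩
  obtain ⟨w, hw, hy⟩ := Part.mem_bind_iff.1 hy
  obtain ⟨τ, hτ, hout, hin⟩ := hA σ v w hz hv (mem_of_mem_mOfFn hw)
  obtain ⟨ρ, hρ, h⟩ := hC (τ.update o y)
  refine hτ.seq (Exec.seq (hF τ w ?_ ?_ ?_ y hy) ?_)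
  · intro r hr
    rw [hout r (by omega), hz r (by omega)]
  · rw [hout o (by omega), ho]
  · exact fun i => hin i i.2
  · convert hρ using 1
    ext r
    have := hz r
    have := hout r
    grind

theorem prec {n : ℕ} {f : List.Vector ℕ n → ℕ} {g : List.Vector ℕ (n + 2) → ℕ}
    (hf : Implementable fun v => Part.some (f v)) (hg : Implementable fun v => Part.some (g v)) :
    Implementable fun v : List.Vector ℕ (n + 1) =>
      Part.some (v.head.rec (f v.tail) fun y IH => g (y ::ᵥ IH ::ᵥ v.tail)) := by
  intro inp o b hb hne hob
  obtain ⟨F, hF⟩ := hf (fun i => inp i.succ) o b (fun i => hb _) (fun i => hne _) hob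
  obtain ⟨G, hG⟩ := hg (Fin.cons (b + 1) (Fin.cons (b + 2) fun i => inp i.succ)) o (b + 3)
    (by
      refine Fin.cases (by simp) (Fin.cases (by simp) fun i => ?_)
      have := hb i.succ
      simp only [Fin.cons_succ]
      omega)
    (by
      refine Fin.cases ?_ (Fin.cases ?_ fun i => ?_)
      · simp only [Fin.cons_zero]
        omega
      · simp only [Fin.cons_succ, Fin.cons_zero]
        omega
      · exact hne i.succ)
    (by omega)
  let body : Fragment Unit :=
    (move o (b + 2)).seq (G.seq ((clear (b + 2)).seq (incReg (b + 1))))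
  refine ⟨F.seq ((copy (inp 0) b (b + 1)).seq ((forReg b body).seq (clear (b + 1)))),
    fun σ v hz ho hv y hy => ?_⟩
  rw [Part.mem_some_iff] at hy
  obtain ⟨φ, hφ₀, hφ, hy⟩ : ∃ φ : ℕ → ℕ, φ 0 = f v.tail ∧
      (∀ k, φ (k + 1) = g (k ::ᵥ φ k ::ᵥ v.tail)) ∧ y = φ v.head :=
    ⟨fun k => Nat.rec (f v.tail) (fun y IH => g (y ::ᵥ IH ::ᵥ v.tail)) k, rfl, fun _ => rfl, hy⟩
  have hz₂ : σ (b + 2) = 0 := hz _ (by omega)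
  have bodyExec : ∀ j k, body.Exec
      ((((σ.update o (φ k)).update b (j + 1)).update (b + 1) k).update b j) ()
      (((σ.update o (φ (k + 1))).update b j).update (b + 1) (k + 1)) := by
    intro j k
    refine Exec.seq (ρ := ((σ.update b j).update (b + 1) k).update (b + 2) (φ k)) ?_ ?_
    · convert exec_move (show o ≠ b + 2 by omega) _ using 1
      clear hF hG hφ hz hv
      ext r
      grind
    refine Exec.seq (hG _ (k ::ᵥ φ k ::ᵥ v.tail) ?_ ?_ ?_ _ (Part.mem_some _))
      (Exec.seq (exec_clear _ _) ?_)
    · intro r hr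
      have := hz r (by omega)
      clear hF hG hφ hz hv
      grind
    · clear hF hG hφ hz hv
      grind
    · refine Fin.cases ?_ (Fin.cases ?_ fun i => ?_)
      · simp [Finsupp.update_apply]
      · simp only [Fin.cons_succ, Fin.cons_zero, List.Vector.get_cons_succ, List.Vector.get_zero,
          List.Vector.head_cons]
        simp [Finsupp.update_apply]
      · have h1 := hb i.succ
        have h3 := hv i.succ
        simp only [Fin.cons_succ, List.Vector.get_cons_succ, List.Vector.get_tail_succ]
        clear hF hG hφ hz hv
        grind
    · convert exec_incReg (b + 1) _ using 1
      rw [← hφ]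
      clear hF hG hφ hz hv
      ext r
      grind
  have iterate : ∀ j k, (forReg b body).Exec
      (((σ.update o (φ k)).update b j).update (b + 1) k) ()
      (((σ.update o (φ (k + j))).update b 0).update (b + 1) (k + j)) := by
    intro j
    induction j with
    | zero =>
      intro k
      exact Exec.forReg_zero (by simp [Finsupp.update_apply])
    | succ j ih =>
      intro k
      refine Exec.forReg_succ (k := j) (by simp [Finsupp.update_apply]) ?_
        (by simpa [add_assoc, add_comm 1] using ih (k + 1))
      exact bodyExec j k
  refine Exec.seq (hF σ v.tail hz ho (fun i => ?_) _ (Part.mem_some _)) ?_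
  · rw [hv, List.Vector.get_tail_succ]
  refine Exec.seq (exec_copy (hb 0).ne (by have := hb 0; omega) (by omega) ?_) ?_
  · have := hz (b + 1) (by omega)
    grind
  have hzb := hz b le_rfl
  have hzb' := hz (b + 1) (by omega)
  have h0 := hv 0
  rw [List.Vector.get_zero] at h0
  have h1 := hne 0
  have hstart := iterate v.head 0
  rw [zero_add] at hstart
  refine Exec.seq (ρ := ((σ.update o (φ v.head)).update b 0).update (b + 1) v.head) ?_ ?_
  · convert hstart using 1
    ext r
    grind
  · convert exec_clear (b + 1) _ using 1
    ext r
    grind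

theorem rfind {n : ℕ} {f : List.Vector ℕ (n + 1) → ℕ}
    (hf : Implementable fun v => Part.some (f v)) :
    Implementable fun v : List.Vector ℕ n =>
      Nat.rfind fun k => Part.some (decide (f (k ::ᵥ v) = 0)) := by
  intro inp o b hb hne hob
  obtain ⟨F, hF⟩ := hf (Fin.cons o inp) b (b + 1)
    (Fin.cases (by simp; omega) fun i => by have := hb i; simp; omega)
    (Fin.cases (by simp; omega) fun i => by have := hb i; simp; omega)
    (by omega)
  refine ⟨F.seq (forReg b ((clear b).seq ((incReg o).seq F))), fun σ v hz ho hv y hy => ?_⟩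
  obtain ⟨hy, hlt⟩ := Nat.mem_rfind.1 hy
  simp only [Part.mem_some_iff, true_eq_decide_iff, false_eq_decide_iff] at hy hlt
  have hzb := hz b le_rfl
  have evaluate : ∀ k, F.Exec (σ.update o k) () ((σ.update o k).update b (f (k ::ᵥ v))) := by
    intro k
    refine hF _ (k ::ᵥ v) ?_ ?_ ?_ _ (Part.mem_some _)
    · intro r hr
      have := hz r (by omega)
      grind
    · grind
    · refine Fin.cases ?_ fun i => ?_
      · simp [Finsupp.update_apply]
      · have h1 := hne i
        have h2 := hv i
        simp only [Fin.cons_succ, List.Vector.get_cons_succ]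
        grind
  have search : ∀ j k, k + j = y → (forReg b ((clear b).seq ((incReg o).seq F))).Exec
      ((σ.update o k).update b (f (k ::ᵥ v))) () (σ.update o y) := by
    intro j
    induction j with
    | zero =>
      rintro k rfl
      rw [add_zero] at hy ⊢
      convert Exec.forReg_zero ?_ using 1
      · ext r
        grind
      · simp [Finsupp.update_apply, hy]
    | succ j ih =>
      intro k hk
      obtain ⟨c, hc⟩ := Nat.exists_eq_succ_of_ne_zero (hlt (m := k) (by omega))
      refine Exec.forReg_succ (k := c) (by simpa [Finsupp.update_apply] using hc)
        (Exec.seq (exec_clear _ _) (Exec.seq (exec_incReg _ _) ?_)) (ih (k + 1) (by omega))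
      convert evaluate (k + 1) using 1
      ext r
      grind
  refine Exec.seq ?_ (search y 0 (zero_add y))
  convert evaluate 0 using 1
  rw [← ho, Finsupp.update_self]

theorem of_primrec {n : ℕ} {f : List.Vector ℕ n → ℕ} (hf : Nat.Primrec' f) :
    Implementable fun v => Part.some (f v) := by
  induction hf with
  | zero => exact zero
  | succ => exact succ
  | get i => exact get i
  | comp g _ _ hf hg => simpa [Vector.mOfFn_part_some] using comp hf hg
  | prec _ _ hf hg => exact prec hf hg

theorem of_partrec {n : ℕ} {f : List.Vector ℕ n →. ℕ} (hf : Nat.Partrec' f) :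
    Implementable f := by
  induction hf with
  | prim hf => exact of_primrec hf
  | comp g _ _ hf hg => exact comp hf hg
  | rfind _ hf => exact rfind hf

end Implementable

/-- A fixed fragment deciding whether `f n` is positive, for all `n` at which `f` is defined. -/
theorem exists_fragment_of_partrec {f : ℕ →. ℕ} (hf : Partrec f) :
    ∃ D : Fragment Bool, ∀ n, ∀ y ∈ f n, D.Run (2 ^ n, 0) (decide (0 < y)) (0, 0) := by
  obtain ⟨F, hF⟩ := Implementable.of_partrec (Nat.Partrec'.part_iff₁.2 hf) (fun _ => 0) 1 2
    (by simp) (by simp) (by simp)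
  refine ⟨F.seq ((decReg 1).bind fun e => (pourFst 0).seq (ret e)), fun n y hy => ?_⟩
  have hrun := hF (Finsupp.single 0 n) (n ::ᵥ List.Vector.nil)
    (fun r hr => Finsupp.single_eq_of_ne (by omega)) (by simp) (fun i => by simp) y hy
  have finish : ∀ (e : Bool) a, ((pourFst 0).seq (ret e)).Run (a, 0) e (0, 0) := fun e a =>
    Run.seq (by simpa using run_pourFst 0 a 0) (run_ret e _)
  unfold Exec at hrun
  rw [godel_single, Nat.nth_prime_zero_eq_two] at hrun
  refine hrun.seq ?_
  cases y with
  | zero => exact Run.bind (exec_decReg_zero (by simp)) (finish false _)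
  | succ y => exact Run.bind (exec_decReg_succ (k := y) (by simp)) (finish true _)

namespace Fragment

/-- The transition function of a fragment whose exits are turned into idle states. -/
def transition {E : Type} (F : Fragment E) : (F.S ⊕ E) → Bool → Bool → (F.S ⊕ E) × ℤ × ℤ
  | Sum.inl s, b₁, b₂ => (F.next s b₁ b₂, F.act s b₁ b₂)
  | Sum.inr e, _, _ => (Sum.inr e, 0, 0)

theorem valid_transition {E : Type} (F : Fragment E) : Valid F.transition := by
  constructor
  · rintro (s | e) b₁ b₂
    · exact F.act_mem s b₁ b₂
    · simp [transition, Deltas]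
  · rintro (s | e) b₁ b₂
    · exact F.act_consistent s b₁ b₂
    · simp [transition]

theorem step_transition_inr {E : Type} (F : Fragment E) (e : E) (c : ℕ × ℕ) :
    step F.transition (Sum.inr e, c) = (Sum.inr e, c) := by
  simp [step, transition]

theorem Reaches.exists_traj {E : Type} {F : Fragment E} {s : F.S} {c d : ℕ × ℕ} {e : E}
    (h : F.Reaches s c e d) : ∃ t, traj F.transition (Sum.inl s, c) t = (Sum.inr e, d) := by
  induction h with
  | @leave s c e h =>
    refine ⟨1, ?_⟩
    rw [← h]
    rfl
  | @step s c s' e d h _ ih =>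
    obtain ⟨t, ht⟩ := ih
    refine ⟨t + 1, ?_⟩
    rw [← ht, traj, Function.iterate_succ_apply, ← h]
    rfl

end Fragment

/-- Transport a transition function along a renaming of the states. -/
def rename {S T : Type*} (u : S ≃ T) (Γ : S → Bool → Bool → S × ℤ × ℤ) :
    T → Bool → Bool → T × ℤ × ℤ :=
  fun s b₁ b₂ => (u (Γ (u.symm s) b₁ b₂).1, (Γ (u.symm s) b₁ b₂).2)

theorem Valid.rename {S T : Type*} (u : S ≃ T) {Γ : S → Bool → Bool → S × ℤ × ℤ}
    (h : Valid Γ) : Valid (rename u Γ) :=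
  ⟨fun s => h.1 (u.symm s), fun s => h.2 (u.symm s)⟩

theorem traj_rename {S T : Type*} (u : S ≃ T) (Γ : S → Bool → Bool → S × ℤ × ℤ) (s : S)
    (c : ℕ × ℕ) (t : ℕ) :
    traj (rename u Γ) (u s, c) t = Prod.map u id (traj Γ (s, c) t) := by
  have : Function.Semiconj (Prod.map u id) (step Γ) (step (rename u Γ)) := by
    intro x
    simp [step, CM.rename]
  exact ((this.iterate_right t) (s, c)).symm

theorem traj_eq_of_le {S : Type*} {Γ : S → Bool → Bool → S × ℤ × ℤ} {x y : S × ℕ × ℕ} {t t' : ℕ}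
    (h : traj Γ x t = y) (hy : step Γ y = y) (htt' : t ≤ t') : traj Γ x t' = y := by
  obtain ⟨k, rfl⟩ := Nat.exists_eq_add_of_le' htt'
  rw [traj, Function.iterate_add_apply]
  exact (congrArg _ h).trans (Function.iterate_fixed hy k)

/-- A single machine and halting configuration for which halting, as a function of the first
counter, separates the zeros of `f` from the points where `f` is positive. -/
theorem exists_machine_of_partrec {f : ℕ →. ℕ} (hf : Partrec f) :
    ∃ (m : ℕ) (Γ : Fin m → Bool → Bool → Fin m × ℤ × ℤ) (s e : Fin m), Valid Γ ∧
      ∀ n, ∀ y ∈ f n, (∃ t, traj Γ (s, 2 ^ n, 0) t = (e, 0, 0)) ↔ 0 < y := by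
  obtain ⟨D, hD⟩ := exists_fragment_of_partrec hf
  have := D.fin
  obtain ⟨m, ⟨u⟩⟩ := Finite.exists_equiv_fin (D.S ⊕ Bool)
  refine ⟨m, rename u D.transition, u (Sum.inl D.start), u (Sum.inr true),
    D.valid_transition.rename u, fun n y hy => ?_⟩
  obtain ⟨t, ht⟩ := (hD n y hy).exists_traj
  simp only [traj_rename]
  constructor
  · rintro ⟨t', ht'⟩
    have ht' : traj D.transition (Sum.inl D.start, 2 ^ n, 0) t' = (Sum.inr true, 0, 0) :=
      (u.injective.prodMap Function.injective_id) ht'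
    have h := traj_eq_of_le ht (D.step_transition_inr _ _) (le_max_left t t')
    rw [traj_eq_of_le ht' (D.step_transition_inr _ _) (le_max_right t t')] at h
    simpa using h
  · intro h
    exact ⟨t, by rw [ht]; simp [h]⟩

/-- Positive values and zeros of a diagonal partial recursive function cannot be separated by a
computable predicate. -/
theorem not_computablePred_of_separates {p : ℕ → Prop}
    (hp : ∀ n, ∀ y ∈ Nat.Partrec.Code.eval (Denumerable.ofNat Nat.Partrec.Code n) n,
      p n ↔ 0 < y) : ¬ ComputablePred p := by
  rintro ⟨_, h⟩
  have hd : Computable fun n => bif decide (p n) then 0 else 1 :=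
    Computable.cond h (Computable.const 0) (Computable.const 1)
  obtain ⟨c, hc⟩ := Nat.Partrec.Code.exists_code.1 (Partrec.nat_iff.1 hd)
  have := hp (Encodable.encode c) (bif decide (p (Encodable.encode c)) then 0 else 1)
    (by rw [Denumerable.ofNat_encode, hc]; exact Part.mem_some _)
  by_cases h : p (Encodable.encode c) <;> simp [h] at this

theorem partrec_diagonal :
    Partrec fun n => Nat.Partrec.Code.eval (Denumerable.ofNat Nat.Partrec.Code n) n :=
  Nat.Partrec.Code.eval_part.comp (Computable.ofNat _) Computable.id

end CM

theorem CMHaltCode.computable_encode_initial {m : ℕ} (Γ : Fin m → Bool → Bool → Fin m × ℤ × ℤ)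
    (s : Fin m) (h : Fin m × ℕ × ℕ) :
    Computable fun n : ℕ => Encodable.encode (⟨m, Γ, (s, 2 ^ n, 0), h⟩ : CMHaltCode) := by
  have hpow : Primrec fun n : ℕ => 2 ^ n :=
    (Primrec.nat_rec₁ 1 (Primrec.nat_mul.comp Primrec.snd (Primrec.const 2)).to₂).of_eq
      fun n => by induction n <;> simp_all [pow_succ]
  have hcode : Primrec fun n : ℕ => Nat.pair (Encodable.encode m) (Nat.pair (Encodable.encode Γ)
      (Nat.pair (Nat.pair (Encodable.encode s) (Nat.pair (2 ^ n) 0)) (Encodable.encode h))) :=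
    Primrec₂.natPair.comp (Primrec.const _) (Primrec₂.natPair.comp (Primrec.const _)
      (Primrec₂.natPair.comp (Primrec₂.natPair.comp (Primrec.const _)
        (Primrec₂.natPair.comp hpow (Primrec.const _))) (Primrec.const _)))
  exact (hcode.of_eq fun n => rfl).to_comp

/-- The halting problem for two-counter machines is undecidable: the set of codes of
triples (counter machine, initial configuration, halting configuration) for which the
halting configuration is reached in finite time is not a computable predicate. -/
theorem halting_problem_of_counter_machines_undecidable :
    ¬ ComputablePred (fun n : ℕ =>
      ∃ M : CMHaltCode, Encodable.encode M = n ∧ CM.Valid M.2.1 ∧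
        ∃ t : ℕ, CM.traj M.2.1 M.2.2.1 t = M.2.2.2) := by
  intro h
  obtain ⟨m, Γ, s, e, hΓ, hsep⟩ := CM.exists_machine_of_partrec CM.partrec_diagonal
  refine CM.not_computablePred_of_separates hsep (ComputablePred.computable_of_manyOneReducible
    ⟨_, CMHaltCode.computable_encode_initial Γ s (e, 0, 0), fun n => ?_⟩ h)
  constructor
  · rintro ⟨t, ht⟩
    exact ⟨_, rfl, hΓ, t, ht⟩
  · rintro ⟨M, hM, _, ht⟩
    obtain rfl := Encodable.encode_injective hM
    exact ht
end

section
/- The halting problem for two-counter machines remains undecidable even when the initial and halting configurations coincide and both counters are zero: the set of codes of pairs (counter machine (S, Γ), state s⁰) such that the trajectory started at configuration (s⁰, 0, 0) returns to the configuration (s⁰, 0, 0) at some time t ≥ 1 is not a computable predicate. -/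
/-- Codes of pairs (two-counter machine with state set `Fin m`, state `s⁰`). -/
def CMStateCode : Type :=
  Σ m : ℕ, (Fin m → Bool → Bool → Fin m × ℤ × ℤ) × Fin m

instance : Encodable CMStateCode := by unfold CMStateCode; infer_instance

namespace CM

section Encoding

open Encodable

theorem encode_list_map_encode {α : Type*} [Encodable α] (l : List α) :
    encode (l.map encode) = encode l := by
  induction l with
  | nil => rfl
  | cons a l ih => simp [ih]

theorem encode_finArrow {α : Type*} [Encodable α] {n : ℕ} (f : Fin n → α) :
    @encode (Fin n → α) finArrow f = encode (List.ofFn f) := by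
  change encode (List.Vector.ofFn f).1 = _
  rw [← List.Vector.toList_ofFn]
  rfl

theorem encode_finPi {α : Type*} [Encodable α] {m : ℕ} (f : Fin m → α) :
    @encode (Fin m → α) (finPi m fun _ => α) f =
      encode (List.ofFn fun i : Fin m => Nat.pair i (encode (f i))) := by
  change @encode (Fin m → Σ _ : Fin m, α) finArrow (fun i => ⟨i, f i⟩) = _
  rw [encode_finArrow, ← encode_list_map_encode, List.map_ofFn]
  rfl

theorem encode_fintypeArrow {α β : Type*} [Encodable α] [Fintype α] [Encodable β] (f : α → β) :
    encode f = encode (List.ofFn fun i : Fin (Fintype.card α) =>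
      Nat.pair i (encode (f (fintypeEquivFin.symm i)))) :=
  encode_finPi fun i => f (fintypeEquivFin.symm i)

theorem encode_fintypeArrow_congr {α β γ : Type*} [Encodable α] [Fintype α] [Encodable β]
    [Encodable γ] {f : α → β} {g : α → γ} (h : ∀ a, encode (f a) = encode (g a)) :
    encode f = encode g := by
  simp only [encode_fintypeArrow, h]

theorem encode_const_bool {β : Type*} [Encodable β] (b : β) :
    encode (fun _ : Bool => b) = encode [Nat.pair 0 (encode b), Nat.pair 1 (encode b)] := by
  rw [encode_fintypeArrow]
  rfl

theorem encode_stateCode {m : ℕ} (Γ : Fin m → Bool → Bool → Fin m × ℤ × ℤ) (s : Fin m)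
    (G : ℕ → Bool → Bool → ℕ × ℤ × ℤ)
    (h : ∀ i b₁ b₂, (((Γ i b₁ b₂).1 : ℕ), (Γ i b₁ b₂).2) = G i b₁ b₂) :
    encode (⟨m, Γ, s⟩ : CMStateCode) =
      Nat.pair m (Nat.pair
        (encode ((List.range m).map fun i => Nat.pair i (encode (G i)))) s) := by
  change Nat.pair m (Nat.pair (@encode (Fin m → _) (finPi m fun _ => _) Γ) s) = _
  rw [encode_finPi]
  congr 3
  refine List.ext_getElem (by simp) fun i h₁ h₂ => ?_
  simp only [List.getElem_ofFn, List.getElem_map, List.getElem_range]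
  congr 1
  refine encode_fintypeArrow_congr fun b₁ => encode_fintypeArrow_congr fun b₂ => ?_
  exact congrArg encode (h ⟨i, by simpa using h₁⟩ b₁ b₂)

end Encoding

/-- Instructions of a two-counter machine with targets in `α`. The test `decᵢ z p` jumps to `z` if
the `i`-th counter is zero, and otherwise decrements it and jumps to `p`. -/
inductive Instr (α : Type*)
  | jmp (q : α)
  | inc₁ (q : α)
  | inc₂ (q : α)
  | dec₁ (z p : α)
  | dec₂ (z p : α)

namespace Instr

variable {α β : Type*}

/-- The effect of an instruction on the two counters, with the state jumped to. -/
def run : Instr α → ℕ × ℕ → α × ℕ × ℕ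
  | jmp q, c => (q, c)
  | inc₁ q, (x, y) => (q, x + 1, y)
  | inc₂ q, (x, y) => (q, x, y + 1)
  | dec₁ z _, (0, y) => (z, 0, y)
  | dec₁ _ p, (x + 1, y) => (p, x, y)
  | dec₂ z _, (x, 0) => (z, x, 0)
  | dec₂ _ p, (x, y + 1) => (p, x, y)

/-- Relabel the targets of an instruction. -/
def map (f : α → β) : Instr α → Instr β
  | jmp q => jmp (f q)
  | inc₁ q => inc₁ (f q)
  | inc₂ q => inc₂ (f q)
  | dec₁ z p => dec₁ (f z) (f p)
  | dec₂ z p => dec₂ (f z) (f p)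

/-- The row of a transition function given by an instruction. -/
def row : Instr α → Bool → Bool → α × ℤ × ℤ
  | jmp q, _, _ => (q, 0, 0)
  | inc₁ q, _, _ => (q, 1, 0)
  | inc₂ q, _, _ => (q, 0, 1)
  | dec₁ z p, b, _ => if b then (p, -1, 0) else (z, 0, 0)
  | dec₂ z p, _, b => if b then (p, 0, -1) else (z, 0, 0)

theorem run_map (f : α → β) (a : Instr α) (c : ℕ × ℕ) :
    (a.map f).run c = Prod.map f id (a.run c) := by
  rcases c with ⟨_ | x, _ | y⟩ <;> cases a <;> rfl

theorem row_map (f : α → β) (a : Instr α) (b₁ b₂ : Bool) :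
    (a.map f).row b₁ b₂ = Prod.map f id (a.row b₁ b₂) := by
  cases a <;> cases b₁ <;> cases b₂ <;> rfl

theorem step_row (code : α → Instr α) (s : α) (c : ℕ × ℕ) :
    CM.step (fun s => (code s).row) (s, c) = (code s).run c := by
  rcases c with ⟨_ | x, _ | y⟩ <;> cases h : code s <;> simp [CM.step, row, run, h] <;> omega

theorem row_mem_deltas (a : Instr α) (b₁ b₂ : Bool) : (a.row b₁ b₂).2 ∈ CM.Deltas := by
  cases a <;> cases b₁ <;> cases b₂ <;> simp [CM.Deltas, row]

theorem row_consistent (a : Instr α) (b₁ b₂ : Bool) :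
    ((a.row b₁ b₂).2.1 = -1 → b₁ = true) ∧ ((a.row b₁ b₂).2.2 = -1 → b₂ = true) := by
  cases a <;> cases b₁ <;> cases b₂ <;> simp [row]

theorem valid_row (code : α → Instr α) : CM.Valid fun s => (code s).row :=
  ⟨fun s => (code s).row_mem_deltas, fun s => (code s).row_consistent⟩

end Instr

variable {S T E F : Type*}

/-- `Exits code s c e c'` says that the machine fragment `code`, started in state `s` with counters
`c`, leaves through the exit `e` with counters `c'`. -/
inductive Exits (code : S → Instr (S ⊕ E)) : S → ℕ × ℕ → E → ℕ × ℕ → Prop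
  | done {s c e c'} (h : (code s).run c = (Sum.inr e, c')) : Exits code s c e c'
  | next {s c s' c' e c''} (h : (code s).run c = (Sum.inl s', c')) (h' : Exits code s' c' e c'') :
      Exits code s c e c''

/-- If a fragment is embedded in another one, its exits being rerouted to states, then the outer
fragment simulates it. -/
theorem Exits.embed {code : S → Instr (S ⊕ E)} {code' : T → Instr (T ⊕ F)} {f : S → T}
    {g : E → T} (h : ∀ s, code' (f s) = (code s).map (Sum.inl ∘ Sum.elim f g))
    {s c e c'} (hs : Exits code s c e c') {o c''} (h' : Exits code' (g e) c' o c'') :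
    Exits code' (f s) c o c'' := by
  induction hs with
  | done hd => exact .next (by rw [h, Instr.run_map, hd]; rfl) h'
  | next hd _ ih => exact .next (by rw [h, Instr.run_map, hd]; rfl) (ih h')

/-- As `Exits.embed`, for a fragment whose exits are rerouted to exits. -/
theorem Exits.embed_exit {code : S → Instr (S ⊕ E)} {code' : T → Instr (T ⊕ F)} {f : S → T}
    {g : E → F} (h : ∀ s, code' (f s) = (code s).map (Sum.map f g))
    {s c e c'} (hs : Exits code s c e c') : Exits code' (f s) c (g e) c' := by
  induction hs with
  | done hd => exact .done (by rw [h, Instr.run_map, hd]; rfl)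
  | next hd _ ih => exact .next (by rw [h, Instr.run_map, hd]; rfl) ih

/-- Sequential composition of fragments. -/
def seqCode (A : S → Instr (S ⊕ Unit)) (B : T → Instr (T ⊕ E)) (t : T) :
    S ⊕ T → Instr ((S ⊕ T) ⊕ E)
  | .inl s => (A s).map (Sum.inl ∘ Sum.elim Sum.inl fun _ => Sum.inr t)
  | .inr s => (B s).map (Sum.map Sum.inr id)

theorem Exits.seq {A : S → Instr (S ⊕ Unit)} {B : T → Instr (T ⊕ E)} {s t c c' e c''}
    (hA : Exits A s c () c') (hB : Exits B t c' e c'') :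
    Exits (seqCode A B t) (.inl s) c e c'' :=
  hA.embed (f := Sum.inl) (g := fun _ => Sum.inr t) (fun _ => rfl)
    (hB.embed_exit (f := Sum.inr) (g := id) fun _ => rfl)

/-- The loop with test `A`, started at `s`, and body `B`, started at `t`. -/
def loopCode (A : S → Instr (S ⊕ Bool)) (s : S) (B : T → Instr (T ⊕ Unit)) (t : T) :
    S ⊕ T → Instr ((S ⊕ T) ⊕ Unit)
  | .inl q => (A q).map (Sum.elim (Sum.inl ∘ Sum.inl) fun b => cond b (.inl (.inr t)) (.inr ()))
  | .inr q => (B q).map (Sum.inl ∘ Sum.elim Sum.inr fun _ => Sum.inl s)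

theorem Exits.loop_false {A : S → Instr (S ⊕ Bool)} {B : T → Instr (T ⊕ Unit)} {s q t c c'}
    (hA : Exits A q c false c') : Exits (loopCode A s B t) (.inl q) c () c' := by
  generalize hb : false = b at hA
  induction hA with
  | done hd => exact .done (by rw [loopCode, Instr.run_map, hd, ← hb]; rfl)
  | next hd _ ih => exact .next (by rw [loopCode, Instr.run_map, hd]; rfl) (ih hb)

theorem Exits.loop_true {A : S → Instr (S ⊕ Bool)} {B : T → Instr (T ⊕ Unit)} {s q t c c' c'' d}
    (hA : Exits A q c true c') (hB : Exits B t c' () c'')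
    (h : Exits (loopCode A s B t) (.inl s) c'' () d) :
    Exits (loopCode A s B t) (.inl q) c () d := by
  generalize hb : true = b at hA
  induction hA with
  | done hd =>
    refine .next (s' := .inr t) (by rw [loopCode, Instr.run_map, hd, ← hb]; rfl) ?_
    exact hB.embed (f := Sum.inr) (g := fun _ => Sum.inl s) (fun _ => rfl) h
  | next hd _ ih => exact .next (by rw [loopCode, Instr.run_map, hd]; rfl) (ih hB hb)

/-- The states of the fragment `arith p`. -/
inductive ArithState (p : ℕ)
  | sub (j : Fin p)
  | carry
  | back
  | back'
  | add (j : Fin (p + 1))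
  | move
  | move'

instance (p : ℕ) : Finite (ArithState p) := by
  refine Finite.of_surjective (α := Fin p ⊕ Fin (p + 1) ⊕ Fin 5)
    (Sum.elim .sub (Sum.elim .add ![.carry, .back, .back', .move, .move'])) ?_
  rintro (j | _ | _ | _ | j | _ | _)
  · exact ⟨.inl j, rfl⟩
  · exact ⟨.inr (.inr 0), rfl⟩
  · exact ⟨.inr (.inr 1), rfl⟩
  · exact ⟨.inr (.inr 2), rfl⟩
  · exact ⟨.inr (.inl j), rfl⟩
  · exact ⟨.inr (.inr 3), rfl⟩
  · exact ⟨.inr (.inr 4), rfl⟩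

open ArithState Instr in
/-- A fragment for multiplication (starting at `move`) and tentative division (starting at
`sub 0`) of the first counter by `p`, when the second counter is zero. -/
def arith (p : ℕ) [NeZero p] : ArithState p → Instr (ArithState p ⊕ Bool)
  | sub j => .dec₁ (.inl (if j = 0 then back else add j.castSucc))
      (.inl (if h : j + 1 < p then sub ⟨j + 1, h⟩ else carry))
  | carry => inc₂ (.inl (sub 0))
  | back => dec₂ (.inr true) (.inl back')
  | back' => inc₁ (.inl back)
  | add j => if h : j = 0 then dec₂ (.inr false) (.inl (add (Fin.last p)))
      else inc₁ (.inl (add (j.pred h).castSucc))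
  | move => dec₁ (.inl (add 0)) (.inl move')
  | move' => inc₂ (.inl move)

section Arith

variable {p : ℕ} [NeZero p]

open ArithState

theorem exits_arith_back (x y : ℕ) : Exits (arith p) back (x, y) true (x + y, 0) := by
  induction y generalizing x with
  | zero => exact .done rfl
  | succ y ih =>
    refine .next (s' := back') rfl (.next (s' := back) (c' := (x + 1, y)) rfl ?_)
    rw [← add_assoc, add_right_comm]
    exact ih _

theorem exits_arith_add (j : ℕ) (hj : j < p + 1) (x y : ℕ) :
    Exits (arith p) (add ⟨j, hj⟩) (x, y) false (x + j + p * y, 0) := by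
  induction y generalizing j x with
  | zero =>
    induction j generalizing x with
    | zero => exact .done rfl
    | succ j ih =>
      refine .next (s' := add ⟨j, by omega⟩) (c' := (x + 1, 0)) rfl ?_
      convert ih (by omega) (x + 1) using 2
      ring
  | succ y ihy =>
    induction j generalizing x with
    | zero =>
      refine .next (s' := add (Fin.last p)) (c' := (x, y)) rfl ?_
      rw [show x + 0 + p * (y + 1) = x + p + p * y by ring]
      exact ihy p (by omega) x
    | succ j ih =>
      refine .next (s' := add ⟨j, by omega⟩) (c' := (x + 1, y + 1)) rfl ?_
      convert ih (by omega) (x + 1) using 2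
      ring

theorem exits_arith_move (x y : ℕ) :
    Exits (arith p) move (x, y) false (p * (x + y), 0) := by
  induction x generalizing y with
  | zero =>
    refine .next (s' := add 0) (c' := (0, y)) rfl ?_
    simpa using exits_arith_add (p := p) 0 (by omega) 0 y
  | succ x ih =>
    refine .next (s' := move') (c' := (x, y)) rfl (.next (s' := move) (c' := (x, y + 1)) rfl ?_)
    convert ih (y + 1) using 3
    ring

theorem exits_arith_sub (j : ℕ) (hj : j < p) (x y : ℕ) :
    (p ∣ x + j → Exits (arith p) (sub ⟨j, hj⟩) (x, y) true ((x + j) / p + y, 0)) ∧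
    (¬ p ∣ x + j → Exits (arith p) (sub ⟨j, hj⟩) (x, y) false (x + j + p * y, 0)) := by
  have hp : 0 < p := Nat.pos_of_neZero p
  induction x generalizing j y with
  | zero =>
    obtain rfl | h0 := Nat.eq_zero_or_pos j
    · refine ⟨fun _ => .next (s' := back) (c' := (0, y)) ?_ ?_, fun h => by simp at h⟩
      · have : (⟨0, hj⟩ : Fin p) = 0 := rfl
        simp [arith, Instr.run, this]
      · simpa using exits_arith_back (p := p) 0 y
    · have hd : ¬ p ∣ j := fun h => by have := Nat.le_of_dvd h0 h; omega
      refine ⟨fun h => absurd (by simpa using h) hd, fun _ =>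
        .next (s' := add ⟨j, by omega⟩) (c' := (0, y)) ?_ (exits_arith_add j _ 0 y)⟩
      have : (⟨j, hj⟩ : Fin p) ≠ 0 := fun h => by
        have := congrArg Fin.val h
        simp at this
        omega
      simp [arith, Instr.run, this]
  | succ x ih =>
    by_cases hj' : j + 1 < p
    · have hr : (arith p (sub ⟨j, hj⟩)).run (x + 1, y) = (.inl (sub ⟨j + 1, hj'⟩), (x, y)) := by
        simp [arith, Instr.run, hj']
      have he : x + 1 + j = x + (j + 1) := by ring
      rw [he]
      exact ⟨fun h => .next hr ((ih (j + 1) hj' y).1 h), fun h => .next hr ((ih (j + 1) hj' y).2 h)⟩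
    · have hr : (arith p (sub ⟨j, hj⟩)).run (x + 1, y) = (.inl carry, (x, y)) := by
        simp [arith, Instr.run, hj']
      have hr' : (arith p carry).run (x, y) = (.inl (sub ⟨0, hp⟩), (x, y + 1)) := rfl
      have he : x + 1 + j = x + p := by omega
      rw [he]
      refine ⟨fun h => .next hr (.next hr' ?_), fun h => .next hr (.next hr' ?_)⟩
      · convert (ih 0 hp (y + 1)).1 (by simpa using h) using 2
        rw [Nat.add_div_right _ hp]
        simp
        ring
      · convert (ih 0 hp (y + 1)).2 (by simpa using h) using 2
        ring

theorem exits_arith_div_true {x : ℕ} :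
    Exits (arith p) (sub 0) (p * x, 0) true (x, 0) := by
  have hp : 0 < p := Nat.pos_of_neZero p
  simpa [hp] using (exits_arith_sub 0 hp (p * x) 0).1 (by simp)

theorem exits_arith_div_false {x : ℕ} (h : ¬ p ∣ x) :
    Exits (arith p) (sub 0) (x, 0) false (x, 0) := by
  simpa using (exits_arith_sub 0 (Nat.pos_of_neZero p) x 0).2 (by simpa using h)

end Arith

open Finsupp

/-- The Gödel number of a store of registers. -/
noncomputable def gödel (σ : ℕ →₀ ℕ) : ℕ :=
  σ.prod fun i e => Nat.nth Nat.Prime i ^ e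

theorem prime_nth (i : ℕ) : (Nat.nth Nat.Prime i).Prime := Nat.prime_nth_prime i

theorem gödel_add_single (σ : ℕ →₀ ℕ) (i k : ℕ) :
    gödel (σ + single i k) = Nat.nth Nat.Prime i ^ k * gödel σ := by
  rw [gödel, prod_add_index' (by simp) (by intros; exact pow_add _ _ _), mul_comm]
  congr 1
  simp

theorem gödel_single (i k : ℕ) : gödel (single i k) = Nat.nth Nat.Prime i ^ k := by
  simp [gödel]

theorem not_dvd_gödel {σ : ℕ →₀ ℕ} {i : ℕ} (h : σ i = 0) : ¬ Nat.nth Nat.Prime i ∣ gödel σ := by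
  rw [gödel, Finsupp.prod, (prime_nth i).prime.dvd_finsetProd_iff]
  rintro ⟨j, hj, hd⟩
  have := (Nat.prime_dvd_prime_iff_eq (prime_nth i) (prime_nth j)).1
    ((prime_nth i).dvd_of_dvd_pow hd)
  have := Nat.nth_injective Nat.infinite_setOfPred_prime this
  subst this
  simp [h] at hj

/-- A relation between stores is implementable if some two-counter fragment transforms the Gödel
number of a store into that of each store related to it. -/
def Impl (R : (ℕ →₀ ℕ) → (ℕ →₀ ℕ) → Prop) : Prop :=
  ∃ (S : Type) (_ : Finite S) (code : S → Instr (S ⊕ Unit)) (s : S),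
    ∀ σ σ', R σ σ' → Exits code s (gödel σ, 0) () (gödel σ', 0)

/-- The loop which, while register `r` is nonzero, decrements it and then performs `R`. -/
inductive Loop (r : ℕ) (R : (ℕ →₀ ℕ) → (ℕ →₀ ℕ) → Prop) : (ℕ →₀ ℕ) → (ℕ →₀ ℕ) → Prop
  | done {σ} (h : σ r = 0) : Loop r R σ σ
  | step {σ τ υ} (h : R σ τ) (h' : Loop r R τ υ) : Loop r R (σ + single r 1) υ

namespace Impl

variable {R R' : (ℕ →₀ ℕ) → (ℕ →₀ ℕ) → Prop}

theorem mono (h : Impl R) (hR : ∀ σ τ, R' σ τ → R σ τ) : Impl R' := by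
  obtain ⟨S, hS, code, s, H⟩ := h
  exact ⟨S, hS, code, s, fun σ τ hst => H _ _ (hR _ _ hst)⟩

protected theorem id : Impl Eq :=
  ⟨Unit, inferInstance, fun _ => .jmp (.inr ()), (), by rintro σ _ rfl; exact .done rfl⟩

theorem comp (h : Impl R) (h' : Impl R') : Impl (Relation.Comp R R') := by
  obtain ⟨S, hS, A, s, hA⟩ := h
  obtain ⟨T, hT, B, t, hB⟩ := h'
  refine ⟨S ⊕ T, inferInstance, seqCode A B t, .inl s, ?_⟩
  rintro σ υ ⟨τ, h₁, h₂⟩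
  exact (hA _ _ h₁).seq (hB _ _ h₂)

theorem inc (r : ℕ) : Impl fun σ τ => τ = σ + single r 1 := by
  have : NeZero (Nat.nth Nat.Prime r) := ⟨(prime_nth r).ne_zero⟩
  refine ⟨_, inferInstance, fun s => (arith (Nat.nth Nat.Prime r) s).map (Sum.map id fun _ => ()),
    .move, ?_⟩
  rintro σ _ rfl
  rw [gödel_add_single, pow_one]
  simpa using (exits_arith_move (gödel σ) 0).embed_exit (f := id) (g := fun _ => ())
    (fun _ => rfl)

theorem loop (r : ℕ) (h : Impl R) : Impl (Loop r R) := by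
  have : NeZero (Nat.nth Nat.Prime r) := ⟨(prime_nth r).ne_zero⟩
  obtain ⟨T, hT, B, t, hB⟩ := h
  refine ⟨_ ⊕ T, inferInstance, loopCode (arith (Nat.nth Nat.Prime r)) (.sub 0) B t,
    .inl (.sub 0), ?_⟩
  intro σ τ h
  induction h with
  | done h => exact (exits_arith_div_false (not_dvd_gödel h)).loop_false
  | step h _ ih =>
    rw [gödel_add_single, pow_one]
    exact exits_arith_div_true.loop_true (hB _ _ h) ih

theorem clear (r : ℕ) : Impl fun σ τ => τ r = 0 ∧ ∃ y, σ = τ + single r y := by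
  refine (Impl.id.loop r).mono ?_
  rintro _ τ ⟨h, y, rfl⟩
  induction y with
  | zero => simpa using Loop.done h
  | succ y ih =>
    rw [single_add, ← add_assoc]
    exact .step rfl ih

theorem move {r t : ℕ} (hrt : r ≠ t) :
    Impl fun σ τ => ∃ υ y, υ r = 0 ∧ σ = υ + single r y ∧ τ = υ + single t y := by
  refine ((inc t).loop r).mono ?_
  rintro _ _ ⟨υ, y, h, rfl, rfl⟩
  induction y generalizing υ with
  | zero => simpa using Loop.done h
  | succ y ih =>
    rw [single_add, ← add_assoc]
    refine .step rfl ?_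
    convert ih (υ + single t 1) (by simp [h, hrt.symm]) using 1
    · abel
    · rw [single_add]; abel

theorem move₂ {r t u : ℕ} (hrt : r ≠ t) (hru : r ≠ u) :
    Impl fun σ τ => ∃ υ y, υ r = 0 ∧ σ = υ + single r y ∧ τ = υ + single t y + single u y := by
  refine (((inc t).comp (inc u)).loop r).mono ?_
  rintro _ _ ⟨υ, y, h, rfl, rfl⟩
  induction y generalizing υ with
  | zero => simpa using Loop.done h
  | succ y ih =>
    rw [single_add, ← add_assoc]
    refine .step ⟨_, rfl, rfl⟩ ?_
    convert ih (υ + single t 1 + single u 1) (by simp [h, hrt.symm, hru.symm]) using 1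
    · abel
    · rw [single_add, single_add]; abel

theorem copy {r t u : ℕ} (hrt : r ≠ t) (hru : r ≠ u) (htu : t ≠ u) :
    Impl fun σ τ => σ u = 0 ∧ τ = σ + single t (σ r) := by
  refine ((move₂ hrt hru).comp (move hru.symm)).mono ?_
  rintro σ _ ⟨h, rfl⟩
  have hσ : σ = σ.erase r + single r (σ r) := (erase_add_single r σ).symm
  refine ⟨_, ⟨σ.erase r, σ r, by simp, hσ, rfl⟩, σ.erase r + single t (σ r), σ r, ?_, rfl, ?_⟩
  · simp [h, hru.symm, htu]
  · conv_lhs => rw [hσ]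
    simp only [coe_add, Pi.add_apply, erase_same, zero_add, single_eq_same]
    abel

end Impl

/-- A partial function is computable with registers if, for all registers `ins` and `B` such that
`ins` are below `B`, its value at the contents of `ins` can be stored in the register `B` when
all registers from `B` on are zero. -/
def RegComputable {n : ℕ} (f : List.Vector ℕ n →. ℕ) : Prop :=
  ∀ (ins : Fin n → ℕ) (B : ℕ), (∀ i, ins i < B) →
    Impl fun σ τ => (∀ r ≥ B, σ r = 0) ∧
      ∃ y ∈ f (List.Vector.ofFn fun i => σ (ins i)), τ = σ + single B y

namespace RegComputable

theorem zero : RegComputable (n := 0) fun _ => Part.some 0 := by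
  refine fun ins B _ => Impl.id.mono ?_
  rintro σ _ ⟨-, y, hy, rfl⟩
  simp [Part.mem_some_iff.1 hy]

theorem get {n : ℕ} (i : Fin n) : RegComputable fun v : List.Vector ℕ n => Part.some (v.get i) := by
  intro ins B h
  have := h i
  refine (Impl.copy (r := ins i) (t := B) (u := B + 1) (by omega) (by omega) (by omega)).mono ?_
  rintro σ _ ⟨hσ, y, hy, rfl⟩
  rw [Part.mem_some_iff, List.Vector.get_ofFn] at hy
  exact ⟨hσ _ (by omega), by rw [hy]⟩

theorem succ : RegComputable (n := 1) fun v => Part.some v.head.succ := by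
  intro ins B h
  refine ((get 0 ins B h).comp (Impl.inc B)).mono ?_
  rintro σ _ ⟨hσ, y, hy, rfl⟩
  rw [Part.mem_some_iff] at hy
  refine ⟨_, ⟨hσ, _, Part.mem_some _, rfl⟩, ?_⟩
  rw [hy, ← List.Vector.get_zero, Nat.succ_eq_add_one, single_add]
  abel

/-- Adding to a block of registers does not change the registers outside of it. -/
theorem add_sum_single_apply {n : ℕ} (σ : ℕ →₀ ℕ) (ys : Fin n → ℕ) {B r : ℕ}
    (hr : r < B ∨ B + n ≤ r) : (σ + ∑ i : Fin n, single (B + i) (ys i)) r = σ r := by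
  rw [Finsupp.add_apply, finsetSum_apply, Finset.sum_eq_zero, add_zero]
  intro i _
  have := i.2
  exact single_eq_of_ne (by omega)

theorem sum_single_apply {n : ℕ} (ys : Fin n → ℕ) (B : ℕ) (i : Fin n) :
    (∑ j : Fin n, single (B + j : ℕ) (ys j)) (B + i) = ys i := by
  rw [finsetSum_apply, Finset.sum_eq_single i]
  · simp
  · intro j _ hj
    exact single_eq_of_ne (by have := Fin.val_ne_of_ne hj; omega)
  · simp

theorem impl_tuple {m n : ℕ} {g : Fin n → List.Vector ℕ m →. ℕ} (hg : ∀ i, RegComputable (g i))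
    (ins : Fin m → ℕ) (B : ℕ) (h : ∀ i, ins i < B) :
    Impl fun σ τ => (∀ r ≥ B, σ r = 0) ∧
      ∃ ys : Fin n → ℕ, (∀ i, ys i ∈ g i (List.Vector.ofFn fun i => σ (ins i))) ∧
        τ = σ + ∑ i : Fin n, single (B + i) (ys i) := by
  induction n with
  | zero =>
    refine Impl.id.mono ?_
    rintro σ _ ⟨-, ys, -, rfl⟩
    simp
  | succ n ih =>
    refine ((ih fun i => hg i.castSucc).comp
      (hg (Fin.last n) ins (B + n) fun i => by have := h i; omega)).mono ?_
    rintro σ _ ⟨hσ, ys, hys, rfl⟩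
    refine ⟨_, ⟨hσ, _, fun i => hys i.castSucc, rfl⟩, fun r hr => ?_, ys (Fin.last n), ?_, ?_⟩
    · rw [add_sum_single_apply _ _ (by omega)]
      exact hσ r (by omega)
    · convert hys (Fin.last n) using 4 with i
      exact add_sum_single_apply _ _ (.inl (h i))
    · rw [Fin.sum_univ_castSucc, add_assoc]
      rfl

theorem impl_clear_block (B n : ℕ) :
    Impl fun σ τ => (∀ i < n, τ (B + i) = 0) ∧
      ∃ ys : Fin n → ℕ, σ = τ + ∑ i : Fin n, single (B + i) (ys i) := by
  induction n with
  | zero =>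
    refine Impl.id.mono ?_
    rintro _ σ ⟨-, ys, rfl⟩
    simp
  | succ n ih =>
    refine ((Impl.clear (B + n)).comp ih).mono ?_
    rintro _ τ ⟨hτ, ys, rfl⟩
    refine ⟨τ + ∑ i : Fin n, single (B + i) (ys i.castSucc), ⟨?_, ys (Fin.last n), ?_⟩,
      fun i hi => hτ i (by omega), _, rfl⟩
    · rw [add_sum_single_apply _ _ (by omega)]
      exact hτ n (by omega)
    · rw [Fin.sum_univ_castSucc, add_assoc]
      rfl

theorem comp {m n : ℕ} {f : List.Vector ℕ n →. ℕ} {g : Fin n → List.Vector ℕ m →. ℕ}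
    {h : List.Vector ℕ m →. ℕ} (hf : RegComputable f) (hg : ∀ i, RegComputable (g i))
    (hh : ∀ v, ∀ z ∈ h v, ∃ ys : Fin n → ℕ, (∀ i, ys i ∈ g i v) ∧ z ∈ f (List.Vector.ofFn ys)) :
    RegComputable h := by
  intro ins B hB
  refine ((((impl_tuple hg ins (B + 1) fun i => (hB i).trans (by omega)).comp
    (hf (fun i => B + 1 + i) (B + 1 + n) fun i => by have := i.2; omega)).comp
    (impl_clear_block (B + 1) n)).comp
    (Impl.move (r := B + 1 + n) (t := B) (by omega))).mono ?_
  rintro σ _ ⟨hσ, z, hz, rfl⟩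
  obtain ⟨ys, hys, hz⟩ := hh _ _ hz
  refine ⟨σ + single (B + 1 + n) z, ⟨_, ⟨_, ⟨fun r hr => hσ r (by omega), ys, hys, rfl⟩,
    fun r hr => ?_, z, ?_, rfl⟩, fun i hi => ?_, ys, by abel⟩, σ, z, hσ _ (by omega), rfl, rfl⟩
  · rw [add_sum_single_apply _ _ (by omega)]
    exact hσ r (by omega)
  · convert hz using 4 with i
    rw [Finsupp.add_apply, sum_single_apply, hσ _ (by omega), zero_add]
  · rw [Finsupp.add_apply, hσ _ (by omega), single_eq_of_ne (by omega), add_zero]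

theorem prec {n : ℕ} {f : List.Vector ℕ n → ℕ} {g : List.Vector ℕ (n + 2) → ℕ}
    (hf : RegComputable (f : List.Vector ℕ n →. ℕ))
    (hg : RegComputable (g : List.Vector ℕ (n + 2) →. ℕ)) :
    RegComputable ((fun v : List.Vector ℕ (n + 1) =>
      v.head.rec (f v.tail) fun y IH => g (y ::ᵥ IH ::ᵥ v.tail) :
        List.Vector ℕ (n + 1) → ℕ) : List.Vector ℕ (n + 1) →. ℕ) := by
  intro ins B hB
  have hB0 := hB 0
  have hBs := fun i : Fin n => hB i.succ
  let insg : Fin (n + 2) → ℕ := Fin.cons (B + 1) (Fin.cons B fun i : Fin n => ins i.succ)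
  have hins : ∀ i, insg i < B + 3 := by
    refine Fin.cases (by simp [insg]) (Fin.cases (by simp [insg]) fun i => ?_)
    simpa [insg] using (hBs i).trans (by omega)
  obtain ⟨R, body, hR⟩ : ∃ R, Impl R ∧ ∀ (υ : ℕ →₀ ℕ) (y j k : ℕ), (∀ r ≥ B, υ r = 0) →
      R (υ + single B y + single (B + 1) j + single (B + 2) k)
        (υ + single B (g (j ::ᵥ y ::ᵥ List.Vector.ofFn fun i => υ (ins i.succ))) +
          single (B + 1) (j + 1) + single (B + 2) k) := by
    refine ⟨_, (((hg insg (B + 3) hins).comp (Impl.clear B)).comp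
      (Impl.move (r := B + 3) (t := B) (by omega))).comp (Impl.inc (B + 1)), ?_⟩
    intro υ y j k hυ
    set z := g (j ::ᵥ y ::ᵥ List.Vector.ofFn fun i => υ (ins i.succ))
    refine ⟨υ + single B z + single (B + 1) j + single (B + 2) k,
      ⟨υ + single (B + 1) j + single (B + 2) k + single (B + 3) z,
        ⟨_, ⟨fun r hr => ?_, z, ?_, rfl⟩, ?_, y, by abel⟩,
        υ + single (B + 1) j + single (B + 2) k, z, ?_, rfl, by abel⟩, ?_⟩
    · simp [hυ r (by omega), single_eq_of_ne (show r ≠ B by omega),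
        single_eq_of_ne (show r ≠ B + 1 by omega), single_eq_of_ne (show r ≠ B + 2 by omega)]
    · have hv : (List.Vector.ofFn fun i =>
          (υ + single B y + single (B + 1) j + single (B + 2) k) (insg i)) =
          j ::ᵥ y ::ᵥ List.Vector.ofFn fun i => υ (ins i.succ) := by
        ext i
        rw [List.Vector.get_ofFn]
        refine Fin.cases (by simp [insg, hυ]) (Fin.cases (by simp [insg, hυ]; rfl) fun i => ?_) i
        have := hBs i
        simp [insg, single_eq_of_ne (show ins i.succ ≠ B by omega),
          single_eq_of_ne (show ins i.succ ≠ B + 1 by omega),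
          single_eq_of_ne (show ins i.succ ≠ B + 2 by omega)]
      rw [hv]
      exact Part.mem_some _
    · simp [hυ]
    · simp [hυ]
    · rw [single_add]
      abel
  refine (((hf (fun i => ins i.succ) B hBs).comp
    (Impl.copy (r := ins 0) (t := B + 2) (u := B + 3) (by omega) (by omega) (by omega))).comp
    (body.loop (B + 2))).comp (Impl.clear (B + 1)) |>.mono ?_
  rintro σ _ ⟨hσ, z, hz, rfl⟩
  set F : ℕ → ℕ := fun k => Nat.rec (f (List.Vector.ofFn fun i => σ (ins i.succ)))
    (fun y IH => g (y ::ᵥ IH ::ᵥ List.Vector.ofFn fun i => σ (ins i.succ))) k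
  have hz : z = F (σ (ins 0)) := by
    rw [PFun.coe_val, Part.mem_some_iff] at hz
    rw [hz, ← List.Vector.get_zero, List.Vector.get_ofFn, List.Vector.tail_ofFn]
  have key : ∀ k j, Loop (B + 2) R (σ + single B (F j) + single (B + 1) j + single (B + 2) k)
      (σ + single B (F (j + k)) + single (B + 1) (j + k)) := by
    intro k
    induction k with
    | zero =>
      intro j
      simp only [single_zero, add_zero]
      exact .done (by simp [hσ])
    | succ k ih =>
      intro j
      rw [single_add, ← add_assoc, show j + (k + 1) = j + 1 + k by omega]
      exact .step (hR σ (F j) j k hσ) (ih (j + 1))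
  refine ⟨_, ⟨_, ⟨_, ⟨hσ, F 0, Part.mem_some _, rfl⟩, ?_, rfl⟩, ?_⟩, ?_, σ (ins 0), rfl⟩
  · simp [hσ]
  · have := key (σ (ins 0)) 0
    simp only [single_zero, add_zero, zero_add] at this
    simpa [single_eq_of_ne hB0.ne, ← hz] using this
  · simp [hσ]

theorem rfind {n : ℕ} {f : List.Vector ℕ (n + 1) → ℕ}
    (hf : RegComputable (f : List.Vector ℕ (n + 1) →. ℕ)) :
    RegComputable fun v : List.Vector ℕ n =>
      Nat.rfind fun k => Part.some (decide (f (k ::ᵥ v) = 0)) := by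
  intro ins B hB
  let insf : Fin (n + 1) → ℕ := Fin.cons B ins
  have hins : ∀ i, insf i < B + 1 := by
    refine Fin.cases (by simp [insf]) fun i => ?_
    simpa [insf] using (hB i).trans B.lt_succ_self
  obtain ⟨R, test, hR⟩ : ∃ R, Impl R ∧ ∀ (υ : ℕ →₀ ℕ) (k : ℕ), (∀ r ≥ B, υ r = 0) →
      R (υ + single B k)
        (υ + single B k + single (B + 1) (f (k ::ᵥ List.Vector.ofFn fun i => υ (ins i)))) := by
    refine ⟨_, hf insf (B + 1) hins, ?_⟩
    intro υ k hυ
    refine ⟨fun r hr => ?_, _, ?_, rfl⟩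
    · simp [hυ r (by omega), single_eq_of_ne (show r ≠ B by omega)]
    · have hv : (List.Vector.ofFn fun i => (υ + single B k) (insf i)) =
          k ::ᵥ List.Vector.ofFn fun i => υ (ins i) := by
        ext i
        rw [List.Vector.get_ofFn]
        refine Fin.cases (by simp [insf, hυ]) (fun i => ?_) i
        simp [insf, single_eq_of_ne (hB i).ne]
      rw [hv]
      exact Part.mem_some _
  obtain ⟨Q, body, hQ⟩ : ∃ Q, Impl Q ∧ ∀ (υ : ℕ →₀ ℕ) (k m : ℕ), (∀ r ≥ B, υ r = 0) →
      Q (υ + single B k + single (B + 1) m) (υ + single B (k + 1) +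
        single (B + 1) (f ((k + 1) ::ᵥ List.Vector.ofFn fun i => υ (ins i)))) := by
    refine ⟨_, ((Impl.clear (B + 1)).comp (Impl.inc B)).comp test, ?_⟩
    intro υ k m hυ
    refine ⟨_, ⟨υ + single B k, ⟨?_, m, rfl⟩, rfl⟩, ?_⟩
    · simp [hυ]
    · rw [add_assoc, ← single_add]
      exact hR υ (k + 1) hυ
  refine (test.comp (body.loop (B + 1))).mono ?_
  rintro σ _ ⟨hσ, z, hz, rfl⟩
  set F : ℕ → ℕ := fun k => f (k ::ᵥ List.Vector.ofFn fun i => σ (ins i))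
  replace hz := Nat.mem_rfind.1 hz
  have hz0 : F z = 0 := by simpa using hz.1
  have hz1 : ∀ k < z, F k ≠ 0 := fun k hk => by simpa using hz.2 hk
  have key : ∀ k j, j + k = z → Loop (B + 1) Q (σ + single B j + single (B + 1) (F j))
      (σ + single B z) := by
    intro k
    induction k with
    | zero =>
      rintro _ rfl
      rw [add_zero] at hz0
      rw [hz0, single_zero, add_zero, add_zero]
      exact .done (by simp [hσ])
    | succ k ih =>
      intro j hj
      obtain ⟨m, hm⟩ := Nat.exists_eq_succ_of_ne_zero (hz1 j (by omega))
      rw [hm, Nat.succ_eq_add_one, single_add, ← add_assoc]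
      exact .step (hQ σ j m hσ) (ih (j + 1) (by omega))
  exact ⟨_, by simpa using hR σ 0 hσ, by simpa using key z 0 (by simp)⟩

theorem of_primrec' {n : ℕ} {f : List.Vector ℕ n → ℕ} (hf : Nat.Primrec' f) :
    RegComputable (f : List.Vector ℕ n →. ℕ) := by
  induction hf with
  | zero => exact zero
  | succ => exact succ
  | get i => exact get i
  | comp g _ _ hf hg =>
    refine hf.comp hg fun v z hz => ⟨fun i => g i v, fun i => Part.mem_some _, hz⟩
  | prec _ _ hf hg => exact hf.prec hg

theorem mem_mOfFn {α : Type*} {n : ℕ} {g : Fin n → Part α} {v : List.Vector α n}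
    (hv : v ∈ List.Vector.mOfFn g) (i : Fin n) : v.get i ∈ g i := by
  induction n with
  | zero => exact i.elim0
  | succ n ih =>
    obtain ⟨a, ha, w, hw, h⟩ : ∃ a ∈ g 0, ∃ w ∈ List.Vector.mOfFn fun i => g i.succ,
        v = a ::ᵥ w := by
      simpa [List.Vector.mOfFn] using hv
    subst h
    exact Fin.cases ha (fun i => ih hw i) i

theorem of_partrec' {n : ℕ} {f : List.Vector ℕ n →. ℕ} (hf : Nat.Partrec' f) :
    RegComputable f := by
  induction hf with
  | prim hf => exact of_primrec' hf
  | comp g _ _ hf hg =>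
    refine hf.comp hg fun v z hz => ?_
    obtain ⟨ys, hys, hz⟩ := Part.mem_bind_iff.1 hz
    exact ⟨ys.get, mem_mOfFn hys, by rwa [List.Vector.ofFn_get]⟩
  | rfind _ hf => exact hf.rfind

end RegComputable

/-- A partial recursive function is computed by a two-counter fragment, taking the input `k` as
`2 ^ k` to the output `y` as `3 ^ y`. -/
theorem exists_exits_of_partrec {f : ℕ →. ℕ} (hf : Partrec f) :
    ∃ (m : ℕ) (code : Fin m → Instr (Fin m ⊕ Unit)) (s : Fin m),
      ∀ k, ∀ y ∈ f k, Exits code s (2 ^ k, 0) () (3 ^ y, 0) := by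
  have h : RegComputable fun v : List.Vector ℕ 1 => f v.head :=
    .of_partrec' (.of_part (hf.comp Computable.vector_head))
  obtain ⟨S, _, code, s, H⟩ := (h (fun _ => 0) 1 fun _ => one_pos).comp (Impl.clear 0)
  have e := Finite.equivFin S
  refine ⟨_, fun i => (code (e.symm i)).map (Sum.map e id), e s, fun k y hy => ?_⟩
  have hs := H (single 0 k) (single 1 y)
    ⟨single 0 k + single 1 y, ⟨fun r hr => ?_, y, ?_, rfl⟩, ?_, k, add_comm _ _⟩
  · rw [gödel_single, gödel_single, Nat.nth_prime_zero_eq_two, Nat.nth_prime_one_eq_three] at hs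
    exact hs.embed_exit (f := e) (g := id) fun i => by simp
  · exact single_eq_of_ne (by omega)
  · simpa [← List.Vector.get_zero] using hy
  · simp

theorem Instr.map_map {α β γ : Type*} (f : α → β) (g : β → γ) (a : Instr α) :
    (a.map f).map g = a.map (g ∘ f) := by
  cases a <;> rfl

theorem Instr.map_congr {α β : Type*} {f g : α → β} (h : ∀ x, f x = g x) (a : Instr α) :
    a.map f = a.map g := by
  rw [funext h]

theorem traj_succ {S : Type*} (Γ : S → Bool → Bool → S × ℤ × ℤ) (c : S × ℕ × ℕ) (t : ℕ) :
    traj Γ c (t + 1) = traj Γ (step Γ c) t := rfl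

theorem traj_trans {S : Type*} {Γ : S → Bool → Bool → S × ℤ × ℤ} {c c' c'' : S × ℕ × ℕ}
    (h : ∃ t, traj Γ c t = c') (h' : ∃ t, traj Γ c' t = c'') : ∃ t, traj Γ c t = c'' := by
  obtain ⟨t, rfl⟩ := h
  obtain ⟨u, rfl⟩ := h'
  exact ⟨u + t, Function.iterate_add_apply _ _ _ _⟩

/-- A configuration from which a fixed point other than `c` can be reached is not periodic. -/
theorem traj_ne_of_fixed {S : Type*} {Γ : S → Bool → Bool → S × ℤ × ℤ} {c c' : S × ℕ × ℕ}
    (h : ∃ t, traj Γ c t = c') (hc' : step Γ c' = c') (hne : c ≠ c') {t : ℕ} (ht : 1 ≤ t) :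
    traj Γ c t ≠ c := by
  intro hp
  obtain ⟨u, hu⟩ := h
  have hper : (step Γ)^[t * u] c = c := by
    rw [Function.iterate_mul]
    exact Function.iterate_fixed hp u
  obtain ⟨v, hv⟩ := Nat.exists_eq_add_of_le' (Nat.le_mul_of_pos_left u ht)
  rw [hv, Function.iterate_add_apply, show (step Γ)^[u] c = c' from hu,
    Function.iterate_fixed hc'] at hper
  exact hne hper.symm

theorem Exits.traj {S T E : Type*} {code : S → Instr (S ⊕ E)} {Q : T → Instr T} {f : S → T}
    {g : E → T} (h : ∀ s, Q (f s) = (code s).map (Sum.elim f g)) {s c e c'}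
    (hs : Exits code s c e c') : ∃ t, CM.traj (fun s => (Q s).row) (f s, c) t = (g e, c') := by
  have hstep : ∀ s c, step (fun s => (Q s).row) (f s, c) =
      Prod.map (Sum.elim f g) id ((code s).run c) := fun s c => by
    rw [Instr.step_row, h, Instr.run_map]
  induction hs with
  | @done s c _ _ hd => exact ⟨1, by rw [traj_succ, hstep, hd]; rfl⟩
  | @next s c _ _ _ _ hd _ ih =>
    obtain ⟨t, ht⟩ := ih
    exact ⟨t + 1, by rw [traj_succ, hstep, hd]; exact ht⟩

section Program

variable {m : ℕ} (H : Fin m → Instr (Fin m ⊕ Unit)) (st : Fin m)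

/-- A program which loads `n + 1` into the first counter, runs the fragment `H` from its state
`st`, and then returns to the state `0` if the first counter is `1` and loops in the state `3`
if it is larger. -/
def program (n : ℕ) : ℕ → Instr ℕ
  | 0 => .jmp (m + n + 4)
  | 1 => .dec₁ 3 2
  | 2 => .dec₁ 0 3
  | 3 => .jmp 3
  | i + 4 =>
    if h : i < m then (H ⟨i, h⟩).map (Sum.elim (fun j : Fin m => (j : ℕ) + 4) fun _ => 1)
    else .inc₁ (if i = m then (st : ℕ) + 4 else i + 3)

/-- The program `program`, with its states restricted to those which are used. -/
def finProgram (n : ℕ) (i : Fin (m + n + 5)) : Instr (Fin (m + n + 5)) :=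
  (program H st n i).map (Fin.ofNat (m + n + 5))

theorem val_ofNat {M x : ℕ} [NeZero M] (h : x < M) : (Fin.ofNat M x : ℕ) = x := Nat.mod_eq_of_lt h

theorem finProgram_map_val (n : ℕ) (i : Fin (m + n + 5)) :
    (finProgram H st n i).map Fin.val = program H st n i := by
  obtain ⟨i, hi⟩ := i
  rw [finProgram, Instr.map_map]
  have hst := st.2
  have hval : ∀ x < m + n + 5, (Fin.val ∘ Fin.ofNat (m + n + 5)) x = x := fun x h => val_ofNat h
  match i with
  | 0 | 1 | 2 | 3 =>
    simp only [program, Instr.map]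
    congr 1 <;> exact hval _ (by omega)
  | i + 4 =>
    simp only [program]
    split_ifs with h h'
    · rw [Instr.map_map]
      refine Instr.map_congr ?_ _
      rintro (j | _)
      · have := j.2
        exact hval _ (by rw [Sum.elim_inl]; omega)
      · exact hval _ (by rw [Sum.elim_inr]; omega)
    all_goals
      simp only [Instr.map]
      rw [hval _ (by omega)]

theorem traj_finProgram (n : ℕ) (c : Fin (m + n + 5) × ℕ × ℕ) (t : ℕ) :
    Prod.map Fin.val id (traj (fun s => (finProgram H st n s).row) c t) =
      traj (fun s => (program H st n s).row) (Prod.map Fin.val id c) t := by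
  induction t generalizing c with
  | zero => rfl
  | succ t ih =>
    rw [traj_succ, traj_succ, ih]
    obtain ⟨s, c⟩ := c
    rw [Instr.step_row, show Prod.map Fin.val id (s, c) = ((s : ℕ), c) from rfl, Instr.step_row,
      ← finProgram_map_val, Instr.run_map]

theorem traj_program_load (n j x : ℕ) :
    ∃ t, traj (fun s => (program H st n s).row) (m + j + 4, x, 0) t =
      ((st : ℕ) + 4, x + j + 1, 0) := by
  induction j generalizing x with
  | zero => exact ⟨1, by simp [Instr.step_row, program, Instr.run, traj]⟩
  | succ j ih =>
    obtain ⟨t, ht⟩ := ih (x + 1)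
    refine ⟨t + 1, ?_⟩
    rw [traj_succ, Instr.step_row]
    convert ht using 2
    · simp [program, Instr.run]
      omega
    · congr 1
      ring

theorem traj_program {n y : ℕ} (h : Exits H st (n + 1, 0) () (y + 1, 0)) :
    ∃ t, traj (fun s => (program H st n s).row) (m + n + 4, 0, 0) t = (2, y, 0) := by
  refine traj_trans (traj_program_load H st n n 0) ?_
  rw [zero_add]
  refine traj_trans (h.traj (f := fun j : Fin m => (j : ℕ) + 4) (g := fun _ => 1) fun s => ?_)
    ⟨1, ?_⟩
  · simp [program]
  · rw [traj_succ, Instr.step_row]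
    rfl

theorem traj_finProgram_return {n : ℕ} (h : Exits H st (n + 1, 0) () (1, 0)) :
    ∃ t, 1 ≤ t ∧ traj (fun s => (finProgram H st n s).row) (0, 0, 0) t = (0, 0, 0) := by
  obtain ⟨t, ht⟩ := traj_trans (c'' := (0, 0, 0)) (traj_program H st h) ⟨1, by
    rw [traj_succ, Instr.step_row]; rfl⟩
  refine ⟨t + 1, by omega, ?_⟩
  refine (Fin.val_injective.prodMap Function.injective_id) ?_
  rw [traj_finProgram, traj_succ, Prod.map_apply, Fin.val_zero, Instr.step_row]
  exact ht

theorem traj_finProgram_ne {n y : ℕ} (h : Exits H st (n + 1, 0) () (y + 2, 0)) {t : ℕ}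
    (ht : 1 ≤ t) :
    traj (fun s => (finProgram H st n s).row) (0, 0, 0) t ≠ (0, 0, 0) := by
  intro hp
  obtain ⟨u, hu⟩ := traj_trans (c'' := (3, y, 0)) (traj_program H st h) ⟨1, by
    rw [traj_succ, Instr.step_row]; rfl⟩
  replace hp := congrArg (Prod.map Fin.val id) hp
  rw [traj_finProgram] at hp
  refine traj_ne_of_fixed (c' := (3, y, 0)) ⟨u + 1, ?_⟩ ?_ ?_ ht hp
  · rw [traj_succ, Prod.map_apply, Fin.val_zero, Instr.step_row]
    exact hu
  · rw [Instr.step_row]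
    rfl
  · simp

/-- The code of the machine `finProgram` with starting state `0`. -/
def stateCode (n : ℕ) : CMStateCode :=
  ⟨m + n + 5, fun s => (finProgram H st n s).row, 0⟩

theorem encode_stateCode_program (n : ℕ) :
    Encodable.encode (stateCode H st n) = Nat.pair (m + n + 5) (Nat.pair (Encodable.encode
      ((List.range (m + n + 5)).map fun i =>
        Nat.pair i (Encodable.encode (program H st n i).row))) 0) := by
  refine encode_stateCode _ _ (fun i => (program H st n i).row) fun i b₁ b₂ => ?_
  rw [← finProgram_map_val, Instr.row_map]
  rfl

theorem primrec_encode_const_bool {β : Type*} [Encodable β] {g : ℕ → β}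
    (hg : Primrec fun n => Encodable.encode (g n)) :
    Primrec fun n => Encodable.encode fun _ : Bool => g n := by
  simp only [encode_const_bool]
  exact Primrec.encode.comp (Primrec.list_cons.comp (Primrec₂.natPair.comp (.const 0) hg)
    (Primrec.list_cons.comp (Primrec₂.natPair.comp (.const 1) hg) (.const [])))

theorem primrec_encode_const_row (d : ℤ × ℤ) :
    Primrec fun q : ℕ => Encodable.encode fun _ _ : Bool => (q, d) :=
  primrec_encode_const_bool (primrec_encode_const_bool
    (Primrec₂.natPair.comp .id (.const (Encodable.encode d))))

theorem primrec₂_encode_row :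
    Primrec₂ fun n i => Encodable.encode (program H st n i).row := by
  have h : ∀ n i, Encodable.encode (program H st n i).row =
      if i = 0 then Encodable.encode fun _ _ : Bool => (m + n + 4, ((0, 0) : ℤ × ℤ))
      else if i < m + 5 then
        ((List.range (m + 5)).map fun i => Encodable.encode (program H st 0 i).row).getD i 0
      else Encodable.encode fun _ _ : Bool => (i - 1, ((1, 0) : ℤ × ℤ)) := by
    intro n i
    split_ifs with h₀ h₁
    · subst h₀
      rfl
    · rw [List.getD_eq_getElem _ _ (by simpa using h₁), List.getElem_map, List.getElem_range]
      match i with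
      | 1 | 2 | 3 | i + 4 => rfl
    · obtain ⟨i, rfl⟩ := Nat.exists_eq_add_of_le' (show 4 ≤ i by omega)
      rw [program, dif_neg (by omega), if_neg (by omega)]
      rfl
  refine Primrec.of_eq (f := fun p : ℕ × ℕ => _) ?_ fun p => (h p.1 p.2).symm
  refine Primrec.ite (Primrec.eq.comp .snd (.const 0)) ((primrec_encode_const_row _).comp ?_)
    (Primrec.ite (Primrec.nat_lt.comp .snd (.const _)) ?_ ((primrec_encode_const_row _).comp ?_))
  · exact Primrec.nat_add.comp (Primrec.nat_add.comp (.const m) .fst) (.const 4)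
  · exact (Primrec.list_getD 0).comp (.const _) .snd
  · exact Primrec.nat_sub.comp .snd (.const 1)

theorem primrec_encode_stateCode : Primrec fun n => Encodable.encode (stateCode H st n) := by
  simp only [encode_stateCode_program]
  have hM : Primrec fun n => m + n + 5 :=
    Primrec.nat_add.comp (Primrec.nat_add.comp (.const m) .id) (.const 5)
  refine Primrec₂.natPair.comp hM (Primrec₂.natPair.comp (Primrec.encode.comp
    (Primrec.list_map (Primrec.list_range.comp hM) ?_)) (.const 0))
  exact Primrec₂.natPair.comp₂ Primrec₂.right (primrec₂_encode_row H st)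

end Program

theorem primrec_two_pow_sub_one : Primrec fun k => 2 ^ k - 1 := by
  have h : Primrec fun k => 2 ^ k :=
    ((Primrec.nat_iff.2 Nat.Primrec.pow).comp (Primrec₂.natPair.comp (.const 2) .id)).of_eq
      fun k => by simp
  exact Primrec.nat_sub.comp h (.const 1)

end CM

/-- The halting problem for two-counter machines remains undecidable even when the
initial and halting configurations coincide and both counters are zero: the set of
codes of pairs `(Γ, s⁰)` such that the trajectory started at `(s⁰, 0, 0)` returns to
`(s⁰, 0, 0)` at some time `t ≥ 1` is not a computable predicate. -/
theorem halting_problem_return_to_start_undecidable :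
    ¬ ComputablePred (fun n : ℕ =>
      ∃ M : CMStateCode, Encodable.encode M = n ∧ CM.Valid M.2.1 ∧
        ∃ t : ℕ, 1 ≤ t ∧ CM.traj M.2.1 (M.2.2, 0, 0) t = (M.2.2, 0, 0)) := by
  intro hP
  have hdiag : Partrec fun k : ℕ =>
      Nat.Partrec.Code.eval (Denumerable.ofNat Nat.Partrec.Code k) k :=
    Nat.Partrec.Code.eval_part.comp (Computable.ofNat _) Computable.id
  obtain ⟨m, H, st, hH⟩ := CM.exists_exits_of_partrec hdiag
  have hpow : ∀ k, 2 ^ k - 1 + 1 = 2 ^ k := fun k => Nat.sub_add_cancel Nat.one_le_two_pow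
  have hcode : Computable fun k => Encodable.encode (CM.stateCode H st (2 ^ k - 1)) :=
    ((CM.primrec_encode_stateCode H st).comp CM.primrec_two_pow_sub_one).to_comp
  obtain ⟨_, hdec⟩ := hP
  have hg := Computable.cond (hdec.comp hcode) (.const 1) (.const 0)
  obtain ⟨c, hc⟩ := Nat.Partrec.Code.exists_code.1 (Partrec.nat_iff.1 hg.partrec)
  set k := Encodable.encode c with hk
  have hE := hH k
  simp only [hk, Denumerable.ofNat_encode, hc, PFun.coe_val, Part.mem_some_iff, forall_eq] at hE
  rw [← hk] at hE
  by_cases h : ∃ M : CMStateCode, Encodable.encode M = Encodable.encode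
      (CM.stateCode H st (2 ^ k - 1)) ∧ CM.Valid M.2.1 ∧
        ∃ t : ℕ, 1 ≤ t ∧ CM.traj M.2.1 (M.2.2, 0, 0) t = (M.2.2, 0, 0)
  · obtain ⟨M, hM, -, t, ht, hr⟩ := id h
    obtain rfl := Encodable.encode_injective hM
    rw [decide_eq_true h, cond_true, ← hpow] at hE
    exact CM.traj_finProgram_ne (y := 1) H st hE ht hr
  · rw [decide_eq_false h, cond_false, ← hpow] at hE
    exact h ⟨_, rfl, CM.Instr.valid_row _, CM.traj_finProgram_return H st hE⟩
end

section
/- The stability problem for two-counter machines is undecidable: the set of codes of pairs (counter machine (S, Γ), state s⁰) such that the machine started at configuration (s⁰, 0, 0) is stable — i.e. sup_t z₁ᵗ < ∞ and sup_t z₂ᵗ < ∞ along its trajectory — is not a computable predicate. -/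
namespace CM

/-- `d` is an admissible increment when the positivity flags of the counters are `b₁`, `b₂`. -/
def Admissible (b₁ b₂ : Bool) (d : ℤ × ℤ) : Prop :=
  d ∈ Deltas ∧ (d.1 = -1 → b₁ = true) ∧ (d.2 = -1 → b₂ = true)

theorem admissible_zero (b₁ b₂ : Bool) : Admissible b₁ b₂ (0, 0) := by
  simp [Admissible, Deltas]

theorem admissible_inc₁ (b₁ b₂ : Bool) : Admissible b₁ b₂ (1, 0) := by
  simp [Admissible, Deltas]

theorem admissible_inc₂ (b₁ b₂ : Bool) : Admissible b₁ b₂ (0, 1) := by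
  simp [Admissible, Deltas]

/-- A two-counter machine fragment which may leave its finite state set through an exit in `E`. -/
structure Mach (E : Type) where
  /-- The states. -/
  S : Type
  finite : Finite S
  /-- The entry state. -/
  start : S
  /-- The transition function. -/
  next : S → Bool → Bool → (S ⊕ E) × ℤ × ℤ
  admissible : ∀ s b₁ b₂, Admissible b₁ b₂ (next s b₁ b₂).2

namespace Mach

variable {E F : Type}

/-- Configurations of a fragment: a state or an exit, and the two counters. -/
abbrev Cfg (M : Mach E) : Type := (M.S ⊕ E) × ℕ × ℕ

/-- The configuration following the state `s` with counters `z`. -/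
def move (M : Mach E) (s : M.S) (z : ℕ × ℕ) : M.Cfg :=
  let r := M.next s (decide (0 < z.1)) (decide (0 < z.2))
  (r.1, ((z.1 : ℤ) + r.2.1).toNat, ((z.2 : ℤ) + r.2.2).toNat)

/-- One step of a fragment. -/
inductive Step (M : Mach E) : M.Cfg → M.Cfg → Prop
  | move (s : M.S) (z : ℕ × ℕ) : Step M (Sum.inl s, z) (M.move s z)

/-- Reachability between configurations of a fragment. -/
def Reach (M : Mach E) : M.Cfg → M.Cfg → Prop := Relation.ReflTransGen M.Step

/-- Started with counters `z`, the fragment leaves through `e` with counters `z'`. -/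
def Exec (M : Mach E) (z : ℕ × ℕ) (e : E) (z' : ℕ × ℕ) : Prop :=
  M.Reach (Sum.inl M.start, z) (Sum.inr e, z')

theorem Reach.map {M : Mach E} {M' : Mach F} (φ : M.S ⊕ E → M'.S ⊕ F)
    (h : ∀ s z, M'.Step (φ (Sum.inl s), z) (φ (M.move s z).1, (M.move s z).2))
    {c c' : M.Cfg} (hc : M.Reach c c') : M'.Reach (φ c.1, c.2) (φ c'.1, c'.2) := by
  induction hc with
  | refl => exact Relation.ReflTransGen.refl
  | tail _ hs ih =>
    cases hs with
    | move s z => exact ih.tail (h s z)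

theorem exec_of_move {M : Mach E} {z z' : ℕ × ℕ} {e : E}
    (h : M.move M.start z = (Sum.inr e, z')) : M.Exec z e z' := by
  have := Step.move (M := M) M.start z
  rw [h] at this
  exact Relation.ReflTransGen.single this

/-- The fragment that leaves through `e` without changing the counters. -/
def pure (e : E) : Mach E where
  S := Unit
  finite := inferInstance
  start := ()
  next _ _ _ := (Sum.inr e, 0, 0)
  admissible _ := admissible_zero

theorem exec_pure (e : E) (z : ℕ × ℕ) : (pure e).Exec z e z :=
  exec_of_move (by simp [move, pure])

/-- Increment the first counter. -/
def inc₁ : Mach Unit where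
  S := Unit
  finite := inferInstance
  start := ()
  next _ _ _ := (Sum.inr (), 1, 0)
  admissible _ := admissible_inc₁

theorem exec_inc₁ (a b : ℕ) : inc₁.Exec (a, b) () (a + 1, b) :=
  exec_of_move (by simp [move, inc₁])

/-- Increment the second counter. -/
def inc₂ : Mach Unit where
  S := Unit
  finite := inferInstance
  start := ()
  next _ _ _ := (Sum.inr (), 0, 1)
  admissible _ := admissible_inc₂

theorem exec_inc₂ (a b : ℕ) : inc₂.Exec (a, b) () (a, b + 1) :=
  exec_of_move (by simp [move, inc₂])

/-- Decrement the first counter if it is positive; the exit tells whether it was. -/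
def dec₁ : Mach Bool where
  S := Unit
  finite := inferInstance
  start := ()
  next _ b _ := (Sum.inr b, if b then -1 else 0, 0)
  admissible _ b₁ b₂ := by cases b₁ <;> simp [Admissible, Deltas]

theorem exec_dec₁_succ (a b : ℕ) : dec₁.Exec (a + 1, b) true (a, b) :=
  exec_of_move (by simp [move, dec₁])

theorem exec_dec₁_zero (b : ℕ) : dec₁.Exec (0, b) false (0, b) :=
  exec_of_move (by simp [move, dec₁])

/-- Decrement the second counter if it is positive; the exit tells whether it was. -/
def dec₂ : Mach Bool where
  S := Unit
  finite := inferInstance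
  start := ()
  next _ _ b := (Sum.inr b, 0, if b then -1 else 0)
  admissible _ b₁ b₂ := by cases b₂ <;> simp [Admissible, Deltas]

theorem exec_dec₂_succ (a b : ℕ) : dec₂.Exec (a, b + 1) true (a, b) :=
  exec_of_move (by simp [move, dec₂])

theorem exec_dec₂_zero (a : ℕ) : dec₂.Exec (a, 0) false (a, 0) :=
  exec_of_move (by simp [move, dec₂])

/-- Run `M`, then run the fragment selected by its exit. -/
def bind [Finite E] (M : Mach E) (K : E → Mach F) : Mach F where
  S := M.S ⊕ Σ e, (K e).S
  finite := by
    have := M.finite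
    have := fun e => (K e).finite
    infer_instance
  start := Sum.inl M.start
  next
    | Sum.inl s, b₁, b₂ =>
      (Sum.inl ((M.next s b₁ b₂).1.map id fun e => ⟨e, (K e).start⟩), (M.next s b₁ b₂).2)
    | Sum.inr ⟨e, s⟩, b₁, b₂ =>
      (((K e).next s b₁ b₂).1.map (fun s' => Sum.inr ⟨e, s'⟩) id, ((K e).next s b₁ b₂).2)
  admissible
    | Sum.inl s, b₁, b₂ => M.admissible s b₁ b₂
    | Sum.inr ⟨e, s⟩, b₁, b₂ => (K e).admissible s b₁ b₂

theorem exec_bind [Finite E] {M : Mach E} {K : E → Mach F} {z z' z'' : ℕ × ℕ} {e : E} {e' : F}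
    (h : M.Exec z e z') (h' : (K e).Exec z' e' z'') : (M.bind K).Exec z e' z'' := by
  refine Relation.ReflTransGen.trans
    (Reach.map (M' := M.bind K)
      (fun c => Sum.inl (c.map id fun e => ⟨e, (K e).start⟩)) ?_ h)
    (Reach.map (M' := M.bind K)
      (fun c => c.map (fun s' => Sum.inr ⟨e, s'⟩) id) ?_ h')
  · intro s z
    exact Step.move (M := M.bind K) (Sum.inl s) z
  · intro s z
    exact Step.move (M := M.bind K) (Sum.inr ⟨e, s⟩) z

/-- Go back to the start when leaving through `none`. -/
def resume (M : Mach (Option E)) : Option E → M.S ⊕ E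
  | none => Sum.inl M.start
  | some e => Sum.inr e

/-- Run `M` again and again until it leaves through an exit `some e`. -/
def iter (M : Mach (Option E)) : Mach E where
  S := M.S
  finite := M.finite
  start := M.start
  next s b₁ b₂ := (Sum.elim Sum.inl M.resume (M.next s b₁ b₂).1, (M.next s b₁ b₂).2)
  admissible := M.admissible

theorem reach_iter {M : Mach (Option E)} {z z' : ℕ × ℕ} {e : Option E} (h : M.Exec z e z') :
    M.iter.Reach (Sum.inl M.start, z) (M.resume e, z') :=
  Reach.map (M := M) (M' := M.iter) (Sum.elim Sum.inl M.resume)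
    (fun s z => Step.move (M := M.iter) s z) h

/-- One round of a loop with test `T` and body `K`. -/
def round (T : Mach Bool) (K : Mach Unit) : Mach (Option Unit) :=
  T.bind fun b => bif b then K.bind fun _ => pure none else pure (some ())

/-- Run `K` as long as the test `T` leaves through `true`. -/
def whileDo (T : Mach Bool) (K : Mach Unit) : Mach Unit := (round T K).iter

theorem reach_whileDo {T : Mach Bool} {K : Mach Unit} {z z' z'' : ℕ × ℕ}
    (h : T.Exec z true z') (h' : K.Exec z' () z'') :
    (T.whileDo K).Reach (Sum.inl (T.whileDo K).start, z) (Sum.inl (T.whileDo K).start, z'') :=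
  have : (round T K).Exec z none z'' := exec_bind h (exec_bind h' (exec_pure none z''))
  reach_iter this

theorem exec_whileDo_true {T : Mach Bool} {K : Mach Unit} {z z' z'' z''' : ℕ × ℕ}
    (h : T.Exec z true z') (h' : K.Exec z' () z'') (h'' : (T.whileDo K).Exec z'' () z''') :
    (T.whileDo K).Exec z () z''' :=
  (reach_whileDo h h').trans h''

theorem exec_whileDo_false {T : Mach Bool} {K : Mach Unit} {z z' : ℕ × ℕ}
    (h : T.Exec z false z') : (T.whileDo K).Exec z () z' :=
  have : (round T K).Exec z (some ()) z' := exec_bind h (exec_pure (some ()) z')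
  reach_iter this

/-- Run two fragments one after the other. -/
def seq (M : Mach Unit) (M' : Mach E) : Mach E := M.bind fun _ => M'

theorem exec_seq {M : Mach Unit} {M' : Mach E} {z z' z'' : ℕ × ℕ} {e : E}
    (h : M.Exec z () z') (h' : M'.Exec z' e z'') : (M.seq M').Exec z e z'' :=
  exec_bind h h'

/-- Add `c` to the first counter. -/
def add₁ : ℕ → Mach Unit
  | 0 => pure ()
  | c + 1 => inc₁.seq (add₁ c)

theorem exec_add₁ (c a b : ℕ) : (add₁ c).Exec (a, b) () (a + c, b) := by
  induction c generalizing a with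
  | zero => exact exec_pure _ _
  | succ c ih =>
    have := exec_seq (exec_inc₁ a b) (ih (a + 1))
    rwa [add_assoc, add_comm 1 c] at this

/-- Add `c` to the second counter. -/
def add₂ : ℕ → Mach Unit
  | 0 => pure ()
  | c + 1 => inc₂.seq (add₂ c)

theorem exec_add₂ (c a b : ℕ) : (add₂ c).Exec (a, b) () (a, b + c) := by
  induction c generalizing b with
  | zero => exact exec_pure _ _
  | succ c ih =>
    have := exec_seq (exec_inc₂ a b) (ih (b + 1))
    rwa [add_assoc, add_comm 1 c] at this

/-- Subtract `c` from the first counter if it is at least `c`; the exit tells whether it was. -/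
def sub₁ : ℕ → Mach Bool
  | 0 => pure true
  | c + 1 => dec₁.bind fun b => bif b then
      (sub₁ c).bind fun b' => bif b' then pure true else inc₁.seq (pure false)
    else pure false

theorem exec_sub₁_add (c a b : ℕ) : (sub₁ c).Exec (a + c, b) true (a, b) := by
  induction c with
  | zero => exact exec_pure _ _
  | succ c ih => exact exec_bind (exec_dec₁_succ (a + c) b) (exec_bind ih (exec_pure _ _))

theorem exec_sub₁_of_lt {c a : ℕ} (h : a < c) (b : ℕ) : (sub₁ c).Exec (a, b) false (a, b) := by
  induction c generalizing a with
  | zero => omega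
  | succ c ih =>
    cases a with
    | zero => exact exec_bind (exec_dec₁_zero b) (exec_pure _ _)
    | succ a =>
      exact exec_bind (exec_dec₁_succ a b)
        (exec_bind (ih (by omega)) (exec_seq (exec_inc₁ a b) (exec_pure _ _)))

/-- Add `c` times the second counter to the first one, and reset the second counter. -/
def drain₂ (c : ℕ) : Mach Unit := dec₂.whileDo (add₁ c)

theorem exec_drain₂ (c a b : ℕ) : (drain₂ c).Exec (a, b) () (a + c * b, 0) := by
  induction b generalizing a with
  | zero => exact exec_whileDo_false (exec_dec₂_zero a)
  | succ b ih =>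
    have := exec_whileDo_true (exec_dec₂_succ a b) (exec_add₁ c a b) (ih (a + c))
    rwa [add_assoc, add_comm c, ← Nat.mul_succ] at this

/-- Add `c` times the first counter to the second one, and reset the first counter. -/
def drain₁ (c : ℕ) : Mach Unit := dec₁.whileDo (add₂ c)

theorem exec_drain₁ (c a b : ℕ) : (drain₁ c).Exec (a, b) () (0, b + c * a) := by
  induction a generalizing b with
  | zero => exact exec_whileDo_false (exec_dec₁_zero b)
  | succ a ih =>
    have := exec_whileDo_true (exec_dec₁_succ a b) (exec_add₂ c a b) (ih (b + c))
    rwa [add_assoc, add_comm c, ← Nat.mul_succ] at this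

/-- Multiply the first counter by `c`. -/
def mul (c : ℕ) : Mach Unit := (drain₁ c).seq (drain₂ 1)

theorem exec_mul (c a : ℕ) : (mul c).Exec (a, 0) () (a * c, 0) := by
  have := exec_seq (exec_drain₁ c a 0) (exec_drain₂ 1 0 (0 + c * a))
  rwa [zero_add, zero_add, one_mul, mul_comm] at this

/-- Divide the first counter by `c`, with the quotient in the second counter. -/
def divMod (c : ℕ) : Mach Unit := (sub₁ c).whileDo inc₂

theorem exec_divMod {c r : ℕ} (hr : r < c) (q b : ℕ) :
    (divMod c).Exec (r + c * q, b) () (r, b + q) := by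
  induction q generalizing b with
  | zero => exact exec_whileDo_false (exec_sub₁_of_lt hr b)
  | succ q ih =>
    have := exec_whileDo_true (exec_sub₁_add c (r + c * q) b) (exec_inc₂ _ b) (ih (b + 1))
    rwa [add_assoc, ← Nat.mul_succ, add_assoc, add_comm 1 q] at this

/-- Divide the first counter by `c` if it is a multiple of `c`; the exit tells whether it was. -/
def divTest (c : ℕ) : Mach Bool :=
  (divMod c).seq <| dec₁.bind fun b => bif b then
    inc₁.seq <| (drain₂ c).seq (pure false) else (drain₂ 1).seq (pure true)

theorem exec_divTest_mul {c : ℕ} (hc : 0 < c) (a : ℕ) :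
    (divTest c).Exec (a * c, 0) true (a, 0) := by
  have : (divTest c).Exec (0 + c * a, 0) true (0 + 1 * (0 + a), 0) :=
    exec_seq (exec_divMod hc a 0) (exec_bind (exec_dec₁_zero _)
      (exec_seq (exec_drain₂ 1 _ _) (exec_pure _ _)))
  simpa only [zero_add, one_mul, mul_comm c] using this

theorem exec_divTest_of_not_dvd {c a : ℕ} (hc : 0 < c) (h : ¬ c ∣ a) :
    (divTest c).Exec (a, 0) false (a, 0) := by
  obtain ⟨r, hr⟩ := Nat.exists_eq_succ_of_ne_zero (mt Nat.dvd_of_mod_eq_zero h)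
  have hlt : r + 1 < c := by simpa only [hr] using Nat.mod_lt a hc
  have : (divTest c).Exec (r + 1 + c * (a / c), 0) false (r + 1 + c * (0 + a / c), 0) :=
    exec_seq (exec_divMod hlt (a / c) 0) (exec_bind (exec_dec₁_succ _ _)
      (exec_seq (exec_inc₁ _ _) (exec_seq (exec_drain₂ c _ _) (exec_pure _ _))))
  rwa [zero_add, ← Nat.succ_eq_add_one, ← hr, Nat.mod_add_div] at this

end Mach

/-- The prime whose exponent stores the register `i`. -/
noncomputable def regPrime (i : ℕ) : ℕ := Nat.nth Nat.Prime i

theorem prime_regPrime (i : ℕ) : (regPrime i).Prime := Nat.prime_nth_prime i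

theorem regPrime_injective : Function.Injective regPrime :=
  Nat.nth_injective Nat.infinite_setOfPred_prime

/-- `N` encodes the register contents `x` through the exponents of the register primes. -/
def Enc (x : ℕ → ℕ) (N : ℕ) : Prop := N ≠ 0 ∧ ∀ i, N.factorization (regPrime i) = x i

theorem Enc.mul {x : ℕ → ℕ} {N : ℕ} (h : Enc x N) (r : ℕ) :
    Enc (Function.update x r (x r + 1)) (N * regPrime r) := by
  refine ⟨mul_ne_zero h.1 (prime_regPrime r).ne_zero, fun i => ?_⟩
  rw [Nat.factorization_mul h.1 (prime_regPrime r).ne_zero, Finsupp.add_apply, h.2,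
    (prime_regPrime r).factorization, Finsupp.single_apply, Function.update_apply]
  by_cases hi : i = r
  · simp [hi]
  · simp [hi, regPrime_injective.ne (Ne.symm hi)]

theorem Enc.dvd_iff {x : ℕ → ℕ} {N : ℕ} (h : Enc x N) (r : ℕ) :
    regPrime r ∣ N ↔ x r ≠ 0 := by
  rw [(prime_regPrime r).dvd_iff_one_le_factorization h.1, h.2, Nat.one_le_iff_ne_zero]

theorem Enc.of_mul {x : ℕ → ℕ} {N r : ℕ} (h : Enc x (N * regPrime r)) :
    Enc (Function.update x r (x r - 1)) N := by
  have hN := left_ne_zero_of_mul h.1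
  refine ⟨hN, fun i => ?_⟩
  have hx := h.2
  simp only [Nat.factorization_mul hN (prime_regPrime r).ne_zero, Finsupp.add_apply,
    (prime_regPrime r).factorization, Finsupp.single_apply] at hx
  rw [Function.update_apply, ← hx i, ← hx r]
  by_cases hi : i = r
  · simp [hi]
  · simp [hi, regPrime_injective.ne (Ne.symm hi)]

theorem Enc.le {x : ℕ → ℕ} {N : ℕ} (h : Enc x N) (r : ℕ) : x r ≤ N :=
  h.2 r ▸ (Nat.factorization_lt _ h.1).le

namespace Mach

/-- The fragment transforms the register contents `x` into `y`. -/
def Runs (M : Mach Unit) (x y : ℕ → ℕ) : Prop :=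
  ∀ N, Enc x N → ∃ N', Enc y N' ∧ M.Exec (N, 0) () (N', 0)

theorem Runs.seq {M M' : Mach Unit} {x y z : ℕ → ℕ} (h : M.Runs x y) (h' : M'.Runs y z) :
    (M.seq M').Runs x z := fun N hN =>
  let ⟨_, h₁, e₁⟩ := h N hN
  let ⟨N₂, h₂, e₂⟩ := h' _ h₁
  ⟨N₂, h₂, exec_seq e₁ e₂⟩

theorem Runs.congr {M : Mach Unit} {x y x' y' : ℕ → ℕ} (h : M.Runs x y) (hx : x = x')
    (hy : y = y') : M.Runs x' y' := hx ▸ hy ▸ h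

theorem runs_skip (x : ℕ → ℕ) : (pure ()).Runs x x := fun N hN => ⟨N, hN, exec_pure _ _⟩

/-- Increment the register `r`. -/
noncomputable def incReg (r : ℕ) : Mach Unit := mul (regPrime r)

theorem runs_incReg (r : ℕ) (x : ℕ → ℕ) :
    (incReg r).Runs x (Function.update x r (x r + 1)) :=
  fun N hN => ⟨_, hN.mul r, exec_mul _ N⟩

/-- While the register `r` is positive, decrement it and run `M`. -/
noncomputable def loop (r : ℕ) (M : Mach Unit) : Mach Unit := (divTest (regPrime r)).whileDo M

theorem Enc.exec_divTest {x : ℕ → ℕ} {N r : ℕ} (h : Enc x N) (hr : x r ≠ 0) :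
    ∃ N', Enc (Function.update x r (x r - 1)) N' ∧
      (divTest (regPrime r)).Exec (N, 0) true (N', 0) := by
  obtain ⟨N', rfl⟩ := (h.dvd_iff r).2 hr
  rw [mul_comm] at h ⊢
  exact ⟨N', h.of_mul, exec_divTest_mul (prime_regPrime r).pos N'⟩

theorem runs_loop_of_eq_zero {x : ℕ → ℕ} {r : ℕ} (h : x r = 0) (M : Mach Unit) :
    (loop r M).Runs x x := fun N hN => ⟨N, hN, exec_whileDo_false
  (exec_divTest_of_not_dvd (prime_regPrime r).pos (by simp [Enc.dvd_iff hN, h]))⟩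

theorem runs_loop_of_ne_zero {x y z : ℕ → ℕ} {r : ℕ} {M : Mach Unit} (h : x r ≠ 0)
    (hM : M.Runs (Function.update x r (x r - 1)) y) (hL : (loop r M).Runs y z) :
    (loop r M).Runs x z := fun _ hN =>
  let ⟨_, h₁, e₁⟩ := Enc.exec_divTest hN h
  let ⟨_, h₂, e₂⟩ := hM _ h₁
  let ⟨N₃, h₃, e₃⟩ := hL _ h₂
  ⟨N₃, h₃, exec_whileDo_true e₁ e₂ e₃⟩

/-- A loop whose body leaves its counter `r` alone; `y j` are the contents of the other registers
after `j` rounds. -/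
theorem runs_loop {r : ℕ} {M : Mach Unit} (n : ℕ) (y : ℕ → ℕ → ℕ)
    (h : ∀ j < n, ∀ k, M.Runs (Function.update (y j) r k) (Function.update (y (j + 1)) r k)) :
    (loop r M).Runs (Function.update (y 0) r n) (Function.update (y n) r 0) := by
  induction n generalizing y with
  | zero => exact runs_loop_of_eq_zero (by simp) M
  | succ n ih =>
    refine runs_loop_of_ne_zero (by simp) (y := Function.update (y 1) r n) ?_
      (ih (fun j => y (j + 1)) fun j hj k => h (j + 1) (by omega) k)
    simpa using h 0 (by omega) n

/-- Reset the register `r`. -/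
noncomputable def clear (r : ℕ) : Mach Unit := loop r (pure ())

theorem runs_clear (r : ℕ) (x : ℕ → ℕ) : (clear r).Runs x (Function.update x r 0) := by
  simpa [clear] using runs_loop (r := r) (M := pure ()) (x r) (fun _ => x) fun j _ k => runs_skip _

/-- Add the register `r` to the register `s`, and reset the register `r`. -/
noncomputable def moveReg (r s : ℕ) : Mach Unit := loop r (incReg s)

theorem runs_moveReg {r s : ℕ} (h : r ≠ s) (x : ℕ → ℕ) :
    (moveReg r s).Runs x (Function.update (Function.update x s (x s + x r)) r 0) := by
  have := runs_loop (r := r) (M := incReg s) (x r) (fun j => Function.update x s (x s + j))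
    fun j _ k => by
      convert runs_incReg s _ using 1
      ext i
      simp only [Function.update_apply]
      split_ifs <;> (simp_all; try omega)
  simpa [moveReg] using this

/-- Add the register `r` to the register `s`, using the empty register `t` as scratch space. -/
noncomputable def copyReg (r s t : ℕ) : Mach Unit :=
  (loop r ((incReg s).seq (incReg t))).seq (moveReg t r)

theorem runs_copyReg {r s t : ℕ} (hrs : r ≠ s) (hrt : r ≠ t) (hst : s ≠ t) {x : ℕ → ℕ}
    (ht : x t = 0) : (copyReg r s t).Runs x (Function.update x s (x s + x r)) := by
  have := runs_loop (r := r) (M := (incReg s).seq (incReg t)) (x r)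
    (fun j => Function.update (Function.update x s (x s + j)) t j)
    fun j _ k => by
      convert (runs_incReg s _).seq (runs_incReg t _) using 1
      ext i
      simp only [Function.update_apply]
      split_ifs <;> (simp_all; try omega)
  refine Runs.seq (Runs.congr this ?_ rfl)
    (Runs.congr (runs_moveReg (Ne.symm hrt) _) rfl ?_)
  · ext i
    simp only [Function.update_apply]
    split_ifs <;> simp_all
  · ext i
    simp only [Function.update_apply]
    split_ifs <;> simp_all

end Mach

namespace Mach

/-- `f` can be computed by a fragment that reads its arguments in any given registers, writes the
value in an empty register `out`, and uses the empty registers `≥ b` as scratch space. -/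
def Computes {n : ℕ} (f : List.Vector ℕ n → ℕ) : Prop :=
  ∀ (ρ : Fin n → ℕ) (out b : ℕ), (∀ i, ρ i < b) → (∀ i, ρ i ≠ out) → out < b →
    ∃ M : Mach Unit, ∀ x : ℕ → ℕ, x out = 0 → (∀ r, b ≤ r → x r = 0) →
      M.Runs x (Function.update x out (f (List.Vector.ofFn fun i => x (ρ i))))

theorem computes_get {n : ℕ} (i : Fin n) : Computes fun v : List.Vector ℕ n => v.get i := by
  intro ρ out b hρ ho hb
  refine ⟨copyReg (ρ i) out b, fun x hx hs => ?_⟩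
  refine (runs_copyReg (ho i) (hρ i).ne hb.ne (hs b le_rfl)).congr rfl ?_
  simp [hx]

theorem computes_succ : Computes (n := 1) fun v => v.head.succ := by
  intro ρ out b hρ ho hb
  refine ⟨(copyReg (ρ 0) out b).seq (incReg out), fun x hx hs => ?_⟩
  refine ((runs_copyReg (ho 0) (hρ 0).ne hb.ne (hs b le_rfl)).seq (runs_incReg _ _)).congr rfl ?_
  simp [hx]

theorem exists_runs_block {m : ℕ} {G : ℕ → List.Vector ℕ m → ℕ} (hG : ∀ i, Computes (G i))
    {ρ : Fin m → ℕ} {b : ℕ} (hρ : ∀ i, ρ i < b) (n : ℕ) :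
    ∃ M : Mach Unit, ∀ x : ℕ → ℕ, (∀ r, b ≤ r → x r = 0) → M.Runs x fun r =>
      if b ≤ r ∧ r < b + n then G (r - b) (List.Vector.ofFn fun i => x (ρ i)) else x r := by
  induction n with
  | zero => exact ⟨pure (), fun x _ => (runs_skip x).congr rfl (by ext r; simp)⟩
  | succ n ih =>
    obtain ⟨M, hM⟩ := ih
    obtain ⟨M', hM'⟩ := hG n ρ (b + n) (b + n + 1) (fun i => (hρ i).trans_le (by omega))
      (fun i => ((hρ i).trans_le (by omega)).ne) (by omega)
    refine ⟨M.seq M', fun x hx => ((hM x hx).seq (hM' _ ?_ ?_)).congr rfl ?_⟩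
    · simp [hx]
    · intro r hr
      simp [show ¬ r < b + n by omega, hx r (by omega)]
    · ext r
      have hρ' : ∀ i, ¬ b ≤ ρ i := fun i => not_le.2 (hρ i)
      simp only [Function.update_apply, hρ', false_and, if_false]
      rcases lt_trichotomy r (b + n) with h | rfl | h
      · simp [h.ne, h, h.trans (Nat.lt_succ_self _), ← add_assoc]
      · simp [← add_assoc]
      · simp [h.ne', show ¬ r < b + n by omega, show ¬ r < b + (n + 1) by omega]

theorem exists_runs_clear (b n : ℕ) : ∃ M : Mach Unit, ∀ x : ℕ → ℕ, M.Runs x fun r =>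
    if b ≤ r ∧ r < b + n then 0 else x r := by
  induction n with
  | zero => exact ⟨pure (), fun x => (runs_skip x).congr rfl (by ext r; simp)⟩
  | succ n ih =>
    obtain ⟨M, hM⟩ := ih
    refine ⟨M.seq (clear (b + n)), fun x => ((hM x).seq (runs_clear _ _)).congr rfl ?_⟩
    ext r
    simp only [Function.update_apply]
    split_ifs <;> first | rfl | omega

theorem computes_comp {m n : ℕ} {f : List.Vector ℕ n → ℕ} {g : Fin n → List.Vector ℕ m → ℕ}
    (hf : Computes f) (hg : ∀ i, Computes (g i)) (hz : Computes fun _ : List.Vector ℕ m => 0) :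
    Computes fun a => f (List.Vector.ofFn fun i => g i a) := by
  intro ρ out b hρ ho hb
  obtain ⟨M₁, h₁⟩ := exists_runs_block
    (G := fun i => if h : i < n then g ⟨i, h⟩ else fun _ => 0)
    (fun i => by split_ifs; exacts [hg _, hz]) hρ n
  obtain ⟨M₂, h₂⟩ := hf (fun i => b + i) out (b + n) (fun i => by simp) (fun i => by omega)
    (by omega)
  obtain ⟨M₃, h₃⟩ := exists_runs_clear b n
  refine ⟨M₁.seq (M₂.seq M₃), fun x hx hs =>
    ((h₁ x hs).seq ((h₂ _ ?_ ?_).seq (h₃ _))).congr rfl ?_⟩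
  · simp [hb.not_ge, hx]
  · intro r hr
    simp [hr.not_gt, hs r (by omega)]
  · ext r
    simp only [Function.update_apply]
    by_cases hr : b ≤ r ∧ r < b + n
    · simp [hr, hs r hr.1, show r ≠ out by omega]
    · simp [hr]

theorem computes_prec {n : ℕ} {f : List.Vector ℕ n → ℕ} {g : List.Vector ℕ (n + 2) → ℕ}
    (hf : Computes f) (hg : Computes g) : Computes fun v : List.Vector ℕ (n + 1) =>
      v.head.rec (f v.tail) fun y IH => g (y ::ᵥ IH ::ᵥ v.tail) := by
  intro ρ out b hρ ho hb
  obtain ⟨M₁, h₁⟩ := hf (fun i => ρ i.succ) out b (fun i => hρ _) (fun i => ho _) hb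
  obtain ⟨M₂, h₂⟩ := hg (Fin.cons b (Fin.cons out fun i => ρ i.succ)) (b + 1) (b + 3)
    (Fin.cases (by simp) (Fin.cases (by simp; omega) fun i => by
      have := hρ i.succ; simp; omega))
    (Fin.cases (by simp) (Fin.cases (by simp; omega) fun i => by
      have := hρ i.succ; simp; omega)) (by omega)
  refine ⟨M₁.seq ((copyReg (ρ 0) (b + 2) b).seq ((loop (b + 2) (M₂.seq ((clear out).seq
    ((moveReg (b + 1) out).seq (incReg b))))).seq (clear b))), fun x hx hs => ?_⟩
  have hb0 := hs b le_rfl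
  have hb1 := hs (b + 1) (by omega)
  have hb2 := hs (b + 2) (by omega)
  have hρ0 := hρ 0
  have ho0 := ho 0
  set w := List.Vector.ofFn fun i => x (ρ i) with hw
  obtain ⟨R, hR, hR0, hRs⟩ : ∃ R : ℕ → ℕ,
      R w.head = w.head.rec (f w.tail) (fun y IH => g (y ::ᵥ IH ::ᵥ w.tail)) ∧
      R 0 = f w.tail ∧ ∀ j, R (j + 1) = g (j ::ᵥ R j ::ᵥ w.tail) :=
    ⟨fun j => j.rec (f w.tail) fun y IH => g (y ::ᵥ IH ::ᵥ w.tail), rfl, rfl, fun _ => rfl⟩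
  have htail : (List.Vector.ofFn fun i : Fin n => x (ρ i.succ)) = w.tail := by
    simp [hw]
  have hhead : w.head = x (ρ 0) := by simp [hw]
  have hloop := runs_loop (r := b + 2) (M := M₂.seq ((clear out).seq
    ((moveReg (b + 1) out).seq (incReg b)))) (x (ρ 0))
    (fun j => Function.update (Function.update x out (R j)) b j) (fun j _ k => by
      refine ((h₂ _ ?_ ?_).seq ((runs_clear _ _).seq ((runs_moveReg (by omega) _).seq
        (runs_incReg _ _)))).congr rfl ?_
      · simp [hb1, show b + 1 ≠ out by omega]
      · intro r hr
        simp [hs r (by omega), show r ≠ out by omega,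
          show r ≠ b by omega, show r ≠ b + 2 by omega]
      · have : (List.Vector.ofFn fun i => Function.update (Function.update
            (Function.update x out (R j)) b j) (b + 2) k
              ((Fin.cons b (Fin.cons out fun i => ρ i.succ) : Fin (n + 2) → ℕ) i)) =
            j ::ᵥ R j ::ᵥ w.tail := by
          rw [← htail]
          simp only [List.Vector.ofFn, Fin.cons_zero, Fin.cons_succ]
          congr 2
          · simp
          · simp [hb.ne, show out ≠ b + 2 by omega]
          · congr 1
            ext i
            have := hρ i.succ
            simp [ho i.succ, show ρ i.succ ≠ b by omega, show ρ i.succ ≠ b + 2 by omega]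
        rw [this, ← hRs j]
        clear this hR hR0 hRs htail h₁ h₂ hw hhead
        clear_value w
        ext r
        simp only [Function.update_apply]
        grind)
  refine ((h₁ x hx hs).seq ((runs_copyReg (by omega) (by omega) (by omega) ?_).seq
    ((hloop.congr ?_ rfl).seq (runs_clear b _)))).congr rfl ?_
  · simp [hb0, hb.ne']
  · rw [htail, ← hR0]
    clear hloop hR hR0 hRs htail h₁ h₂ hw hhead
    ext r
    simp only [Function.update_apply]
    grind
  · ext r
    change _ = Function.update x out (w.head.rec _ _) r
    rw [← hR, hhead]
    clear hloop hR hR0 hRs htail h₁ h₂ hw hhead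
    simp only [Function.update_apply]
    grind

theorem computes_of_primrec' {n : ℕ} {f : List.Vector ℕ n → ℕ} (hf : Nat.Primrec' f) :
    Computes f := by
  have hz : ∀ m, Computes fun _ : List.Vector ℕ m => 0 := fun m _ out _ _ _ _ =>
    ⟨pure (), fun x hx _ => (runs_skip x).congr rfl (by simp [← hx])⟩
  induction hf with
  | zero => exact hz 0
  | succ => exact computes_succ
  | get i => exact computes_get i
  | comp g _ _ ihf ihg => exact computes_comp ihf ihg (hz _)
  | prec _ _ ihf ihg => exact computes_prec ihf ihg

end Mach

/-- The register contents `n, t, a, 0, 0, …`. -/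
def searchRegs (n t a : ℕ) : ℕ → ℕ :=
  Function.update (Function.update (Function.update 0 0 n) 1 t) 2 a

theorem enc_searchRegs (n : ℕ) : Enc (searchRegs n 0 1) (regPrime 0 ^ n * regPrime 2) := by
  have h : ∀ n, Enc (Function.update 0 0 n) (regPrime 0 ^ n) := by
    intro n
    induction n with
    | zero => exact ⟨by simp, fun i => by simp⟩
    | succ n ih => simpa [pow_succ] using ih.mul 0
  have h1 : Function.update (Function.update (0 : ℕ → ℕ) 0 n) 1 0 =
      Function.update (0 : ℕ → ℕ) 0 n :=
    Function.update_eq_self_iff.2 (by simp)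
  simpa [searchRegs, h1] using (h n).mul 2

namespace Mach

/-- Unbounded search for a zero of a primitive recursive function: the first counter of the
resulting fragment is unbounded if the search fails. -/
theorem exists_search {h : List.Vector ℕ 2 → ℕ} (hh : Nat.Primrec' h) (h1 : ∀ v, h v ≤ 1) :
    ∃ M : Mach Unit, ∀ n,
      ((∃ t, h (n ::ᵥ (t + 1) ::ᵥ List.Vector.nil) = 0) →
        ∃ z, M.Exec (regPrime 0 ^ n * regPrime 2, 0) () z) ∧
      ((∀ t, h (n ::ᵥ (t + 1) ::ᵥ List.Vector.nil) ≠ 0) → ∀ B, ∃ s z, B ≤ z.1 ∧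
        M.Reach (Sum.inl M.start, regPrime 0 ^ n * regPrime 2, 0) (Sum.inl s, z)) := by
  obtain ⟨H, hH⟩ := computes_of_primrec' hh (fun i => i) 2 3 (fun i => by omega)
    (fun i => by omega) (by omega)
  set T := divTest (regPrime 2)
  set K := (incReg 1).seq H
  have body : ∀ n t, K.Runs (searchRegs n t 0)
      (searchRegs n (t + 1) (h (n ::ᵥ (t + 1) ::ᵥ List.Vector.nil))) := by
    intro n t
    refine ((runs_incReg 1 _).seq (hH _ ?_ ?_)).congr rfl ?_
    · simp [searchRegs]
    · intro r hr
      simp [searchRegs, show r ≠ 0 by omega, show r ≠ 1 by omega, show r ≠ 2 by omega]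
    · ext r
      simp only [searchRegs, List.Vector.ofFn, Function.update_apply]
      by_cases h2 : r = 2 <;> by_cases h1 : r = 1 <;> simp [h1, h2]
  have round : ∀ n t N, Enc (searchRegs n t 1) N → ∃ N' N'',
      Enc (searchRegs n (t + 1) (h (n ::ᵥ (t + 1) ::ᵥ List.Vector.nil))) N'' ∧
      T.Exec (N, 0) true (N', 0) ∧ K.Exec (N', 0) () (N'', 0) := by
    intro n t N hN
    obtain ⟨N', h', e'⟩ := Enc.exec_divTest hN (r := 2) (by simp [searchRegs])
    obtain ⟨N'', h'', e''⟩ := body n t N' (by simpa [searchRegs] using h')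
    exact ⟨N', N'', h'', e', e''⟩
  have reach : ∀ n t, (∀ t' < t, h (n ::ᵥ (t' + 1) ::ᵥ List.Vector.nil) ≠ 0) →
      ∃ N, Enc (searchRegs n t 1) N ∧ (T.whileDo K).Reach
        (Sum.inl (T.whileDo K).start, regPrime 0 ^ n * regPrime 2, 0)
        (Sum.inl (T.whileDo K).start, N, 0) := by
    intro n t ht
    induction t with
    | zero => exact ⟨_, enc_searchRegs n, Relation.ReflTransGen.refl⟩
    | succ t ih =>
      obtain ⟨N, hN, e⟩ := ih fun t' ht' => ht t' (by omega)
      obtain ⟨N', N'', h'', e', e''⟩ := round n t N hN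
      have : h (n ::ᵥ (t + 1) ::ᵥ List.Vector.nil) = 1 :=
        le_antisymm (h1 _) (Nat.one_le_iff_ne_zero.2 (ht t (by omega)))
      rw [this] at h''
      exact ⟨N'', h'', e.trans (reach_whileDo e' e'')⟩
  refine ⟨T.whileDo K, fun n => ⟨fun hn => ?_, fun hn B => ?_⟩⟩
  · classical
    obtain ⟨N, hN, e⟩ := reach n (Nat.find hn) fun t' ht' => Nat.find_min hn ht'
    obtain ⟨N', N'', h'', e', e''⟩ := round n _ N hN
    rw [Nat.find_spec hn] at h''
    obtain ⟨N₃, -, e₃⟩ := runs_loop_of_eq_zero (r := 2) (by simp [searchRegs]) K N'' h''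
    exact ⟨_, e.trans (exec_whileDo_true e' e'' e₃)⟩
  · obtain ⟨N, hN, e⟩ := reach n B fun t' _ => hn t'
    exact ⟨_, _, by simpa [searchRegs] using hN.le 1, e⟩

/-! ### Turning fragments into counter machines -/

/-- The number of states of a fragment. -/
noncomputable def size (M : Mach Unit) : ℕ := Nat.card M.S

/-- A numbering of the states of a fragment. -/
noncomputable def equivFin (M : Mach Unit) : M.S ≃ Fin M.size :=
  have := M.finite
  Finite.equivFin M.S

/-- The number of a state of a fragment; the number `0` stands for the exit. -/
noncomputable def idx (M : Mach Unit) : M.S ⊕ Unit → ℕ :=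
  Sum.elim (fun s => M.equivFin s + 1) fun _ => 0

theorem idx_lt (M : Mach Unit) (c : M.S ⊕ Unit) : M.idx c < M.size + 1 := by
  rcases c with s | _ <;> simp [idx]

/-- Transition table of the counter machine simulating a fragment: the state `0` halts, the states
`1, …, M.size` are those of the fragment, and the following ones load the first counter. -/
noncomputable def table (M : Mach Unit) : ℕ → Bool → Bool → ℕ × ℤ × ℤ
  | 0, _, _ => (0, 0, 0)
  | i + 1, b₁, b₂ =>
    if h : i < M.size then
      (M.idx (M.next (M.equivFin.symm ⟨i, h⟩) b₁ b₂).1, (M.next (M.equivFin.symm ⟨i, h⟩) b₁ b₂).2)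
    else if i = M.size then (M.idx (Sum.inl M.start), 1, 0)
    else (i, 1, 0)

theorem table_lt (M : Mach Unit) (L : ℕ) {i : ℕ} (hi : i < M.size + 1 + L) (b₁ b₂ : Bool) :
    (M.table i b₁ b₂).1 < M.size + 1 + L := by
  rcases i with _ | i
  · exact hi
  · simp only [table]
    split_ifs
    · exact Nat.lt_add_right L (M.idx_lt _)
    · exact Nat.lt_add_right L (M.idx_lt (Sum.inl M.start))
    · omega

theorem table_admissible (M : Mach Unit) (i : ℕ) (b₁ b₂ : Bool) :
    Admissible b₁ b₂ (M.table i b₁ b₂).2 := by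
  rcases i with _ | i
  · exact admissible_zero _ _
  · simp only [table]
    split_ifs
    · exact M.admissible _ _ _
    · exact admissible_inc₁ _ _
    · exact admissible_inc₁ _ _

theorem table_idx (M : Mach Unit) (s : M.S) (b₁ b₂ : Bool) :
    M.table (M.idx (Sum.inl s)) b₁ b₂ = (M.idx (M.next s b₁ b₂).1, (M.next s b₁ b₂).2) := by
  simp [idx, table]

/-- The counter machine simulating a fragment with `L` additional states loading the first
counter. -/
noncomputable def toCM (M : Mach Unit) (L : ℕ) (i : Fin (M.size + 1 + L)) (b₁ b₂ : Bool) :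
    Fin (M.size + 1 + L) × ℤ × ℤ :=
  (⟨(M.table i b₁ b₂).1, M.table_lt L i.2 b₁ b₂⟩, (M.table i b₁ b₂).2)

theorem valid_toCM (M : Mach Unit) (L : ℕ) : Valid (M.toCM L) :=
  ⟨fun i b₁ b₂ => (M.table_admissible i b₁ b₂).1, fun i b₁ b₂ => (M.table_admissible i b₁ b₂).2⟩

/-- The state of the counter machine corresponding to a state of the fragment. -/
noncomputable def state (M : Mach Unit) (L : ℕ) (c : M.S ⊕ Unit) : Fin (M.size + 1 + L) :=
  ⟨M.idx c, (M.idx_lt c).trans_le (by omega)⟩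

theorem step_toCM (M : Mach Unit) (L : ℕ) (s : M.S) (z : ℕ × ℕ) :
    step (M.toCM L) (M.state L (Sum.inl s), z) = (M.state L (M.move s z).1, (M.move s z).2) := by
  simp [step, toCM, state, move, table_idx]

theorem step_toCM_exit (M : Mach Unit) (L : ℕ) (z : ℕ × ℕ) :
    step (M.toCM L) (M.state L (Sum.inr ()), z) = (M.state L (Sum.inr ()), z) := by
  simp [step, toCM, state, idx, table]

theorem traj_add {S : Type*} (Γ : S → Bool → Bool → S × ℤ × ℤ) (c : S × ℕ × ℕ) (t u : ℕ) :
    traj Γ c (t + u) = traj Γ (traj Γ c t) u := by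
  simp only [traj, add_comm t u, Function.iterate_add_apply]

theorem Reach.exists_traj {M : Mach Unit} {c c' : M.Cfg} (h : M.Reach c c') (L : ℕ) :
    ∃ t, traj (M.toCM L) (M.state L c.1, c.2) t = (M.state L c'.1, c'.2) := by
  induction h with
  | refl => exact ⟨0, rfl⟩
  | tail _ hs ih =>
    obtain ⟨t, ht⟩ := ih
    cases hs with
    | move s z =>
      refine ⟨t + 1, ?_⟩
      rw [traj_add, ht]
      exact M.step_toCM L s z

theorem traj_load (M : Mach Unit) (L j z : ℕ) (hj : M.size + j + 1 < M.size + 1 + L) :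
    traj (M.toCM L) (⟨M.size + j + 1, hj⟩, z, 0) (j + 1) =
      (M.state L (Sum.inl M.start), z + (j + 1), 0) := by
  induction j generalizing z with
  | zero => simp [traj, step, toCM, table, state]
  | succ j ih =>
    rw [add_comm (j + 1) 1, traj_add]
    have : traj (M.toCM L) (⟨M.size + (j + 1) + 1, hj⟩, z, 0) 1 =
        (⟨M.size + j + 1, by omega⟩, z + 1, 0) := by
      simp [traj, step, toCM, table]
      omega
    rw [this, ih]
    exact congrArg (fun k => (M.state L (Sum.inl M.start), k, 0)) (by omega)

theorem stable_of_traj_eq {S : Type*} {Γ : S → Bool → Bool → S × ℤ × ℤ} {c c' : S × ℕ × ℕ} {t : ℕ}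
    (h : traj Γ c t = c') (hc : step Γ c' = c') : Stable Γ c := by
  refine ⟨(Finset.range (t + 1)).sup fun u => (traj Γ c u).2.1 + (traj Γ c u).2.2, fun u => ?_⟩
  have key : ∀ u ≤ t, (traj Γ c u).2.1 + (traj Γ c u).2.2 ≤
      (Finset.range (t + 1)).sup fun u => (traj Γ c u).2.1 + (traj Γ c u).2.2 := fun u hu =>
    Finset.le_sup (f := fun u => (traj Γ c u).2.1 + (traj Γ c u).2.2)
      (Finset.mem_range.2 (Nat.lt_succ_of_le hu))
  obtain hu | hu := le_total u t
  · have := key u hu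
    omega
  · obtain ⟨v, rfl⟩ := Nat.exists_eq_add_of_le hu
    have := key t le_rfl
    rw [traj_add, h, traj, Function.iterate_fixed hc]
    rw [h] at this
    omega

/-- The initial state of `M.toCM L`. -/
noncomputable def loadStart (M : Mach Unit) (L : ℕ) : Fin (M.size + 1 + L) := ⟨M.size + L, by omega⟩

theorem traj_loadStart (M : Mach Unit) {L : ℕ} (hL : 0 < L) :
    traj (M.toCM L) (M.loadStart L, 0, 0) L = (M.state L (Sum.inl M.start), L, 0) := by
  obtain ⟨j, rfl⟩ := Nat.exists_eq_add_of_lt hL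
  simpa [loadStart, add_assoc] using M.traj_load (0 + j + 1) (0 + j) 0 (by omega)

theorem stable_of_exec {M : Mach Unit} {L : ℕ} (hL : 0 < L) {z : ℕ × ℕ}
    (h : M.Exec (L, 0) () z) : Stable (M.toCM L) (M.loadStart L, 0, 0) := by
  obtain ⟨t, ht⟩ := Reach.exists_traj h L
  refine stable_of_traj_eq (t := L + t) ?_ (M.step_toCM_exit L z)
  rw [traj_add, M.traj_loadStart hL, ht]

theorem not_stable_of_reach {M : Mach Unit} {L : ℕ} (hL : 0 < L)
    (h : ∀ B, ∃ s z, B ≤ z.1 ∧ M.Reach (Sum.inl M.start, L, 0) (Sum.inl s, z)) :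
    ¬ Stable (M.toCM L) (M.loadStart L, 0, 0) := by
  rintro ⟨B, hB⟩
  obtain ⟨s, z, hz, hr⟩ := h (B + 1)
  obtain ⟨t, ht⟩ := Reach.exists_traj hr L
  have := (hB (L + t)).1
  rw [traj_add, M.traj_loadStart hL, ht] at this
  exact absurd (hz.trans this) (by simp)


/-! ### Computability of the codes of the simulating machines -/

section Encoding

open Encodable

theorem encode_finPi {β : Type*} [Encodable β] {n : ℕ} (f : Fin n → β) :
    @encode _ (finPi n fun _ => β) f = encode (List.ofFn fun i => Nat.pair i (encode (f i))) := by
  change encode (List.Vector.ofFn fun i => (⟨i, f i⟩ : Σ _ : Fin n, β)).1 = _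
  have h : ∀ l : List (Σ _ : Fin n, β),
      encode l = encode (l.map fun p => Nat.pair p.1 (encode p.2)) := by
    intro l
    induction l with
    | nil => rfl
    | cons p l ih =>
      rw [List.map_cons, encode_list_cons, encode_list_cons, ← ih]
      rfl
  refine (h (List.Vector.ofFn fun i => (⟨i, f i⟩ : Σ _ : Fin n, β)).toList).trans ?_
  rw [List.Vector.toList_ofFn, List.map_ofFn]
  rfl

theorem encode_finPi_congr {α β : Type*} [Encodable α] [Encodable β] {n : ℕ} {f : Fin n → α}
    {g : Fin n → β} (h : ∀ i, encode (f i) = encode (g i)) :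
    @encode _ (finPi n fun _ => α) f = @encode _ (finPi n fun _ => β) g := by
  simp only [encode_finPi, h]

theorem encode_boolArrow_congr {α β : Type*} [Encodable α] [Encodable β] {f : Bool → α}
    {g : Bool → β} (h : ∀ b, encode (f b) = encode (g b)) : encode f = encode g :=
  encode_finPi_congr fun _ => h _

theorem encode_toCM (M : Mach Unit) (L : ℕ) :
    encode (M.toCM L) = encode ((List.range (M.size + 1 + L)).map fun i =>
      Nat.pair i (encode (M.table i))) := by
  refine (encode_finPi _).trans ?_
  have h : ∀ i, encode (M.toCM L i) = encode (M.table i) := fun i =>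
    encode_boolArrow_congr fun b₁ => encode_boolArrow_congr fun b₂ => rfl
  simp only [h]
  congr 1
  exact List.ext_getElem (by simp) (by simp)

/-- The code of the function on `Bool` with constant value of code `x`. -/
def constCode (x : ℕ) : ℕ := encode [Nat.pair 0 x, Nat.pair 1 x]

theorem primrec_constCode : Primrec constCode := by
  unfold constCode
  have h : ∀ i : ℕ, Primrec fun x => Nat.pair i x := fun i =>
    Primrec₂.natPair.comp (Primrec.const i) Primrec.id
  exact Primrec.encode.comp
    (Primrec.list_cons.comp (h 0) (Primrec.list_cons.comp (h 1) (Primrec.const [])))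

theorem encode_boolArrow_const {α : Type*} [Encodable α] (a : α) :
    encode (fun _ : Bool => a) = constCode (encode a) :=
  (encode_finPi _).trans (by rfl)

theorem primrec_encode_table (M : Mach Unit) : Primrec fun i => encode (M.table i) := by
  have h : (fun i => encode (M.table i)) = fun i => if i < M.size + 2 then
      ((List.range (M.size + 2)).map fun i => encode (M.table i)).getD i 0
      else constCode (constCode (Nat.pair (i - 1) (encode ((1, 0) : ℤ × ℤ)))) := by
    ext i
    split_ifs with hi
    · simp [hi]
    · have : M.table i = fun _ _ => (i - 1, 1, 0) := by
        obtain ⟨j, rfl⟩ := Nat.exists_eq_add_of_le (not_lt.1 hi)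
        ext1 b₁
        ext1 b₂
        simp [show M.size + 2 + j = M.size + 1 + j + 1 by omega, table,
          show ¬ M.size + 1 + j < M.size by omega, show M.size + 1 + j ≠ M.size by omega]
      rw [this, encode_boolArrow_const, encode_boolArrow_const, encode_prod_val, encode_nat]
  rw [h]
  refine Primrec.ite (Primrec.nat_lt.comp Primrec.id (Primrec.const _))
    ((Primrec.list_getD 0).comp (Primrec.const _) Primrec.id) ?_
  exact primrec_constCode.comp (primrec_constCode.comp
    (Primrec₂.natPair.comp (Primrec.nat_sub.comp Primrec.id (Primrec.const 1)) (Primrec.const _)))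

/-- The instance of the stability problem given by `M.toCM L` and its initial state. -/
noncomputable def instanceCode (M : Mach Unit) (L : ℕ) : CMStateCode :=
  ⟨M.size + 1 + L, M.toCM L, M.loadStart L⟩

theorem primrec_encode_instanceCode (M : Mach Unit) :
    Primrec fun L => encode (M.instanceCode L) := by
  have h : (fun L => encode (M.instanceCode L)) = fun L => Nat.pair (M.size + 1 + L) (Nat.pair
      (encode ((List.range (M.size + 1 + L)).map fun i => Nat.pair i (encode (M.table i))))
      (M.size + L)) := by
    ext L
    rw [← encode_toCM]
    rfl
  rw [h]
  have hs : Primrec fun L => M.size + 1 + L :=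
    Primrec.nat_add.comp (Primrec.const _) Primrec.id
  refine Primrec₂.natPair.comp hs (Primrec₂.natPair.comp (Primrec.encode.comp
    (Primrec.list_map (Primrec.list_range.comp hs) ?_))
    (Primrec.nat_add.comp (Primrec.const _) Primrec.id))
  exact Primrec₂.natPair.comp Primrec.snd ((primrec_encode_table M).comp Primrec.snd)

end Encoding

end Mach

theorem primrec_pow (b : ℕ) : Primrec fun n => b ^ n := by
  refine (Primrec.nat_rec' (f := id) (g := fun _ : ℕ => 1) (h := fun _ p => p.2 * b) Primrec.id
    (Primrec.const _) (Primrec.nat_mul.comp (Primrec.snd.comp Primrec.snd)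
      (Primrec.const b))).of_eq fun n => ?_
  induction n with
  | zero => rfl
  | succ n ih => simpa [pow_succ] using congrArg (· * b) ih

/-- The value is `0` if the program with code `n` halts on input `0` within time `t`, and `1`
otherwise. -/
def running (n t : ℕ) : ℕ :=
  if (Nat.Partrec.Code.evaln t (Denumerable.ofNat Nat.Partrec.Code n) 0).isSome then 0 else 1

theorem primrec_running : Primrec₂ running := by
  have h : Primrec fun p : ℕ × ℕ =>
      Nat.Partrec.Code.evaln p.2 (Denumerable.ofNat Nat.Partrec.Code p.1) 0 :=
    Nat.Partrec.Code.primrec_evaln.comp (((Primrec.snd).pair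
      ((Primrec.ofNat _).comp Primrec.fst)).pair (Primrec.const 0))
  exact Primrec.ite (Primrec.eq.comp (Primrec.option_isSome.comp h) (Primrec.const true))
    (Primrec.const 0) (Primrec.const 1)

theorem exists_running_eq_zero_iff (c : Nat.Partrec.Code) :
    (∃ t, running (Encodable.encode c) (t + 1) = 0) ↔ (c.eval 0).Dom := by
  simp only [running, Denumerable.ofNat_encode, Part.dom_iff_mem,
    Nat.Partrec.Code.evaln_complete]
  constructor
  · rintro ⟨t, ht⟩
    have : (Nat.Partrec.Code.evaln (t + 1) c 0).isSome := by
      by_contra h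
      simp [h] at ht
    obtain ⟨x, hx⟩ := Option.isSome_iff_exists.1 this
    exact ⟨x, t + 1, hx⟩
  · rintro ⟨x, t, hx⟩
    have := Nat.Partrec.Code.evaln_mono (Nat.le_succ t) hx
    exact ⟨t, if_pos (Option.isSome_iff_exists.2 ⟨x, this⟩)⟩

end CM

/-- The stability problem for two-counter machines is undecidable: the set of codes of
pairs `(Γ, s⁰)` such that the machine started at configuration `(s⁰, 0, 0)` is stable
(both counters remain bounded along the trajectory) is not a computable predicate. -/
theorem stability_of_counter_machines_undecidable :
    ¬ ComputablePred (fun n : ℕ =>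
      ∃ M : CMStateCode, Encodable.encode M = n ∧ CM.Valid M.2.1 ∧
        CM.Stable M.2.1 (M.2.2, 0, 0)) := by
  obtain ⟨M, hM⟩ := CM.Mach.exists_search (h := fun v => CM.running v.head v.tail.head)
    (Nat.Primrec'.prim_iff₂.2 CM.primrec_running) fun v => by
      simp only [CM.running]
      split_ifs <;> simp
  set L : ℕ → ℕ := fun n => CM.regPrime 0 ^ n * CM.regPrime 2
  have hL : Primrec L := Primrec.nat_mul.comp (CM.primrec_pow _) (Primrec.const _)
  have hpos : ∀ n, 0 < L n := fun n =>
    Nat.mul_pos (Nat.pow_pos (CM.prime_regPrime 0).pos) (CM.prime_regPrime 2).pos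
  refine fun hc => ComputablePred.halting_problem 0
    (ComputablePred.computable_of_manyOneReducible
      ⟨fun c => Encodable.encode (M.instanceCode (L (Encodable.encode c))),
        (M.primrec_encode_instanceCode.comp (hL.comp Primrec.encode)).to_comp, fun c => ?_⟩ hc)
  refine (CM.exists_running_eq_zero_iff c).symm.trans ?_
  constructor
  · intro h
    obtain ⟨z, hz⟩ := (hM _).1 h
    exact ⟨_, rfl, M.valid_toCM _, CM.Mach.stable_of_exec (hpos _) hz⟩
  · rintro ⟨M', h, -, hst⟩
    obtain rfl := Encodable.encode_injective h
    by_contra hn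
    exact CM.Mach.not_stable_of_reach (hpos _) ((hM _).2 fun t ht => hn ⟨t, ht⟩) hst
end

section
/- With the construction of Proposition 1 (S' = S ⊕ (S × D), Γ'(inl s, b₁, b₂) = (inr (s', Δ), Δ) where (s', Δ) = Γ(s, b₁, b₂), and Γ'(inr (s', Δ), b₁, b₂) = (inl s', (0,0))): if (sᵗ, z₁ᵗ, z₂ᵗ), t ≥ 0, is the trajectory of (S, Γ) from (s⁰, z₁⁰, z₂⁰) and (σᵘ, ζ₁ᵘ, ζ₂ᵘ), u ≥ 0, is the trajectory of (S', Γ') from (inl s⁰, z₁⁰, z₂⁰), then for every t ≥ 0: (σ^{2t}, ζ₁^{2t}, ζ₂^{2t}) = (inl sᵗ, z₁ᵗ, z₂ᵗ), and (σ^{2t+1}, ζ₁^{2t+1}, ζ₂^{2t+1}) = (inr (s^{t+1}, Δᵗ), z₁^{t+1}, z₂^{t+1}) where (s^{t+1}, Δᵗ) = Γ(sᵗ, 1{z₁ᵗ>0}, 1{z₂ᵗ>0}). -/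
theorem CM.traj_succ_s4 {S : Type*} (Γ : S → Bool → Bool → S × ℤ × ℤ) (c : S × ℕ × ℕ) (t : ℕ) :
    CM.traj Γ c (t + 1) = CM.step Γ (CM.traj Γ c t) :=
  Function.iterate_succ_apply' _ _ _

theorem CM.step_simplify_inl {S : Type*} (Γ : S → Bool → Bool → S × ℤ × ℤ)
    (h : ∀ s b₁ b₂, (Γ s b₁ b₂).2 ∈ CM.Deltas) (c : S × ℕ × ℕ) :
    CM.step (CM.simplify Γ h) (Sum.inl c.1, c.2) =
      (Sum.inr ((CM.step Γ c).1,
        ⟨(Γ c.1 (decide (0 < c.2.1)) (decide (0 < c.2.2))).2, h _ _ _⟩), (CM.step Γ c).2) :=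
  rfl

theorem CM.step_simplify_inr {S : Type*} (Γ : S → Bool → Bool → S × ℤ × ℤ)
    (h : ∀ s b₁ b₂, (Γ s b₁ b₂).2 ∈ CM.Deltas) (p : S × CM.Delta) (z : ℕ × ℕ) :
    CM.step (CM.simplify Γ h) (Sum.inr p, z) = (Sum.inl p.1, z) := by
  simp [CM.step, CM.simplify]

/-- The trajectory of the simplified machine `Γ'` from `(inl s⁰, z₁⁰, z₂⁰)` emulates the
trajectory of `Γ` from `(s⁰, z₁⁰, z₂⁰)`: at even times `2t` it is `(inl sᵗ, z₁ᵗ, z₂ᵗ)`,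
and at odd times `2t + 1` it is `(inr (s^{t+1}, Δᵗ), z₁^{t+1}, z₂^{t+1})`, where
`(s^{t+1}, Δᵗ) = Γ sᵗ 1{z₁ᵗ > 0} 1{z₂ᵗ > 0}`. -/
theorem simplify_traj_correspondence {S : Type*} [Fintype S] [Nonempty S]
    (Γ : S → Bool → Bool → S × ℤ × ℤ) (hΓ : CM.Valid Γ)
    (s0 : S) (z10 z20 : ℕ) (t : ℕ) :
    CM.traj (CM.simplify Γ hΓ.1) (Sum.inl s0, z10, z20) (2 * t) =
      (Sum.inl (CM.traj Γ (s0, z10, z20) t).1, (CM.traj Γ (s0, z10, z20) t).2) ∧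
    CM.traj (CM.simplify Γ hΓ.1) (Sum.inl s0, z10, z20) (2 * t + 1) =
      (let c := CM.traj Γ (s0, z10, z20) t
       let b₁ := decide (0 < c.2.1)
       let b₂ := decide (0 < c.2.2)
       (Sum.inr ((Γ c.1 b₁ b₂).1, ⟨(Γ c.1 b₁ b₂).2, hΓ.1 c.1 b₁ b₂⟩),
        (CM.traj Γ (s0, z10, z20) (t + 1)).2)) := by
  have even_time : CM.traj (CM.simplify Γ hΓ.1) (Sum.inl s0, z10, z20) (2 * t) =
      (Sum.inl (CM.traj Γ (s0, z10, z20) t).1, (CM.traj Γ (s0, z10, z20) t).2) := by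
    induction t with
    | zero => rfl
    | succ t ih =>
      rw [Nat.mul_succ, CM.traj_succ_s4, CM.traj_succ_s4, ih, CM.step_simplify_inl,
        CM.step_simplify_inr, CM.traj_succ_s4]
  refine ⟨even_time, ?_⟩
  rw [CM.traj_succ_s4, even_time, CM.step_simplify_inl, CM.traj_succ_s4]
  rfl
end
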